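/- arXiv:2603.16168 — 2 statements merged into one kernel-verified Lean document; each statement's English description precedes it below -/
import Mathlib

section
/- Symmetric comparison principle: Suppose Hamiltonians H₁ and H₂ satisfy conditions (A.1)–(A.5) and σ : C → ℝ satisfies (A.6). Let φ₁ be an upper solution of the Cauchy problem with Hamiltonian H₁, let φ₂ be a lower solution of the Cauchy problem with Hamiltonian H₂ (both with boundary functional σ), and fix (t,x(·)) ∈ [0,T) × C. Suppose that for every y(·) ∈ Y(t,x(·);c_{H₁}(·)) there exists a set E = E(y(·)) ⊂ [t,T] with μ(E) = T − t such that H₁(τ,y(·),s) ≥ H₂(τ,y(·),s) for all τ ∈ E and s ∈ ℝⁿ. Then φ₁(t,x(·)) ≥ φ₂(t,x(·)). -/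
open MeasureTheory Set Filter Topology

noncomputable section

attribute [local instance] Classical.propDecidable

/-- Euclidean space `ℝⁿ`. -/
abbrev Euc (n : ℕ) : Type := EuclideanSpace ℝ (Fin n)

/-- The path space `C([-h,T], ℝⁿ)` with the sup norm. -/
abbrev PathSp (n : ℕ) (h T : ℝ) : Type := ContinuousMap (Set.Icc (-h) T) (Euc n)

/-- The time map `τ ↦ τ ∧ t` on `[-h,T]` (for `t ∈ [0,T]`, `h ≥ 0`, this is `min τ t`). -/
def stopTime (h T t : ℝ) (τ : Set.Icc (-h) T) : Set.Icc (-h) T :=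
  ⟨max (-h) (min τ.1 t), le_max_left _ _,
    max_le (le_trans τ.2.1 τ.2.2) (le_trans (min_le_left _ _) τ.2.2)⟩

lemma continuous_stopTime (h T t : ℝ) : Continuous (stopTime h T t) :=
  Continuous.subtype_mk
    (continuous_const.max (continuous_subtype_val.min continuous_const)) _

/-- The stopped path `x(· ∧ t)`. -/
def stopPath {n : ℕ} {h T : ℝ} (t : ℝ) (x : PathSp n h T) : PathSp n h T :=
  x.comp ⟨stopTime h T t, continuous_stopTime h T t⟩

/-- Evaluation of a path at a real time (times outside `[-h,T]` are projected). -/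
def evalP {n : ℕ} {h T : ℝ} (x : PathSp n h T) (τ : ℝ) : Euc n :=
  if hc : -h ≤ T then x (Set.projIcc (-h) T hc τ) else 0

/-- The `L¹([0,T])` distance between two functions. -/
def L1dist (T : ℝ) (c₁ c₂ : ℝ → ℝ) : ℝ := ∫ τ in Set.Icc (0:ℝ) T, |c₁ τ - c₂ τ|

/-- A nonnegative function in `L¹([0,T],ℝ)`. -/
def IntegNonneg (T : ℝ) (c : ℝ → ℝ) : Prop :=
  IntegrableOn c (Set.Icc 0 T) volume ∧ ∀ τ ∈ Set.Icc (0:ℝ) T, 0 ≤ c τ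

/-- `AC(t,x(·))`, presented with an explicit derivative witness: pairs `(y, y')`
such that `y(·∧t) = x(·∧t)`, `y'` is integrable on `[t,T]`, and `y` is the
indefinite integral of `y'` on `[t,T]` (i.e. `y|_{[t,T]}` is absolutely continuous
with a.e. derivative `y'`). -/
def ACPair {n : ℕ} {h T : ℝ} (t : ℝ) (x : PathSp n h T) :
    Set (PathSp n h T × (ℝ → Euc n)) :=
  {p | stopPath t p.1 = stopPath t x ∧ IntervalIntegrable p.2 volume t T ∧
       ∀ τ ∈ Set.Icc t T, evalP p.1 τ = evalP p.1 t + ∫ ξ in t..τ, p.2 ξ}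

/-- The set `AC(t,x(·))`. -/
def ACSet {n : ℕ} {h T : ℝ} (t : ℝ) (x : PathSp n h T) : Set (PathSp n h T) :=
  {y | ∃ y', (y, y') ∈ ACPair t x}

/-- Pairs `(y, y')` with `y ∈ Y(t,x(·);c(·))` and derivative witness `y'`. -/
def YPair {n : ℕ} {h T : ℝ} (t : ℝ) (x : PathSp n h T) (c : ℝ → ℝ) :
    Set (PathSp n h T × (ℝ → Euc n)) :=
  {p | p ∈ ACPair t x ∧
       ∀ᵐ τ ∂(volume.restrict (Set.Icc t T)), ‖p.2 τ‖ ≤ c τ * (1 + ‖stopPath τ p.1‖)}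

/-- The set `Y(t,x(·);c(·))`. -/
def YSet {n : ℕ} {h T : ℝ} (t : ℝ) (x : PathSp n h T) (c : ℝ → ℝ) :
    Set (PathSp n h T) :=
  {y | ∃ y', (y, y') ∈ YPair t x c}

/-- Condition (A.1): measurability in `t` on `[0,T]`. -/
def CondA1 {n : ℕ} {h T : ℝ} (H : ℝ → PathSp n h T → Euc n → ℝ) : Prop :=
  ∀ (x : PathSp n h T) (s : Euc n),
    Measurable ((Set.Icc (0:ℝ) T).restrict (fun t => H t x s))

/-- Condition (A.2): continuity in `(x,s)` for a.e. `t`. -/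
def CondA2 {n : ℕ} {h T : ℝ} (H : ℝ → PathSp n h T → Euc n → ℝ) : Prop :=
  ∃ E : Set ℝ, E ⊆ Set.Icc 0 T ∧ volume E = ENNReal.ofReal T ∧
    ∀ t ∈ E, Continuous (fun p : PathSp n h T × Euc n => H t p.1 p.2)

/-- Condition (A.3) for a given compact set `D` and function `λ_H(·;D)`. -/
def CondA3For {n : ℕ} {h T : ℝ} (H : ℝ → PathSp n h T → Euc n → ℝ)
    (D : Set (PathSp n h T)) (lam : ℝ → ℝ) : Prop :=
  IntegNonneg T lam ∧
  ∀ x₁ ∈ D, ∀ x₂ ∈ D, ∀ s : Euc n,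
    ∃ E : Set ℝ, E ⊆ Set.Icc 0 T ∧ volume E = ENNReal.ofReal T ∧
      ∀ t ∈ E, |H t x₁ s - H t x₂ s| ≤
        lam t * (1 + ‖s‖) * ‖stopPath t x₁ - stopPath t x₂‖

/-- Condition (A.3). -/
def CondA3 {n : ℕ} {h T : ℝ} (H : ℝ → PathSp n h T → Euc n → ℝ) : Prop :=
  ∀ D : Set (PathSp n h T), IsCompact D → ∃ lam : ℝ → ℝ, CondA3For H D lam

/-- Condition (A.4), with the function `c_H(·)` made explicit. -/
def CondA4 {n : ℕ} {h T : ℝ} (H : ℝ → PathSp n h T → Euc n → ℝ) (cH : ℝ → ℝ) : Prop :=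
  IntegNonneg T cH ∧
  ∃ E : Set ℝ, E ⊆ Set.Icc 0 T ∧ volume E = ENNReal.ofReal T ∧
    ∀ t ∈ E, ∀ (x : PathSp n h T) (s₁ s₂ : Euc n),
      |H t x s₁ - H t x s₂| ≤ cH t * (1 + ‖stopPath t x‖) * ‖s₁ - s₂‖

/-- Condition (A.5) for a given compact set `D` and function `m_H(·;D)`. -/
def CondA5For {n : ℕ} {h T : ℝ} (H : ℝ → PathSp n h T → Euc n → ℝ)
    (D : Set (PathSp n h T)) (m : ℝ → ℝ) : Prop :=
  IntegNonneg T m ∧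
  ∀ x ∈ D, ∃ E : Set ℝ, E ⊆ Set.Icc 0 T ∧ volume E = ENNReal.ofReal T ∧
    ∀ t ∈ E, |H t x (0 : Euc n)| ≤ m t

/-- Condition (A.5). -/
def CondA5 {n : ℕ} {h T : ℝ} (H : ℝ → PathSp n h T → Euc n → ℝ) : Prop :=
  ∀ D : Set (PathSp n h T), IsCompact D → ∃ m : ℝ → ℝ, CondA5For H D m

/-- Conditions (A.1)–(A.5), with the function `c_H(·)` from (A.4) made explicit. -/
def CondA {n : ℕ} {h T : ℝ} (H : ℝ → PathSp n h T → Euc n → ℝ) (cH : ℝ → ℝ) : Prop :=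
  CondA1 H ∧ CondA2 H ∧ CondA3 H ∧ CondA4 H cH ∧ CondA5 H

/-- A functional `φ` on `[0,T] × C` is non-anticipative. -/
def NonAnticipative {n : ℕ} {h T : ℝ} (φ : ℝ → PathSp n h T → ℝ) : Prop :=
  ∀ t ∈ Set.Icc (0:ℝ) T, ∀ x : PathSp n h T, φ t x = φ t (stopPath t x)

/-- Property (U) from the definition of an upper solution. -/
def PropU {n : ℕ} {h T : ℝ} (H : ℝ → PathSp n h T → Euc n → ℝ) (cH : ℝ → ℝ)
    (φ : ℝ → PathSp n h T → ℝ) : Prop :=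
  ∀ t ∈ Set.Ico (0:ℝ) T, ∀ x : PathSp n h T, ∀ s : Euc n, ∀ τ ∈ Set.Ioc t T,
    ∃ p ∈ YPair t x cH,
      φ τ p.1 - ∫ ξ in t..τ, (@inner ℝ _ _ s (p.2 ξ) - H ξ p.1 s) ≤ φ t x

/-- Property (L) from the definition of a lower solution. -/
def PropL {n : ℕ} {h T : ℝ} (H : ℝ → PathSp n h T → Euc n → ℝ) (cH : ℝ → ℝ)
    (φ : ℝ → PathSp n h T → ℝ) : Prop :=
  ∀ t ∈ Set.Ico (0:ℝ) T, ∀ x : PathSp n h T, ∀ s : Euc n, ∀ τ ∈ Set.Ioc t T,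
    ∃ p ∈ YPair t x cH,
      φ t x ≤ φ τ p.1 - ∫ ξ in t..τ, (@inner ℝ _ _ s (p.2 ξ) - H ξ p.1 s)

/-- Upper solution of the Cauchy problem for `H` (with `c_H` from (A.4)) and `σ`. -/
def UpperSol {n : ℕ} {h T : ℝ} (H : ℝ → PathSp n h T → Euc n → ℝ) (cH : ℝ → ℝ)
    (σ : PathSp n h T → ℝ) (φ : ℝ → PathSp n h T → ℝ) : Prop :=
  NonAnticipative φ ∧
  LowerSemicontinuousOn (fun p : ℝ × PathSp n h T => φ p.1 p.2)
    (Set.Icc 0 T ×ˢ (Set.univ : Set (PathSp n h T))) ∧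
  (∀ x : PathSp n h T, σ x ≤ φ T x) ∧
  PropU H cH φ

/-- Lower solution of the Cauchy problem for `H` (with `c_H` from (A.4)) and `σ`. -/
def LowerSol {n : ℕ} {h T : ℝ} (H : ℝ → PathSp n h T → Euc n → ℝ) (cH : ℝ → ℝ)
    (σ : PathSp n h T → ℝ) (φ : ℝ → PathSp n h T → ℝ) : Prop :=
  NonAnticipative φ ∧
  UpperSemicontinuousOn (fun p : ℝ × PathSp n h T => φ p.1 p.2)
    (Set.Icc 0 T ×ˢ (Set.univ : Set (PathSp n h T))) ∧
  (∀ x : PathSp n h T, φ T x ≤ σ x) ∧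
  PropL H cH φ

/-- Minimax solution of the Cauchy problem. -/
def MinimaxSol {n : ℕ} {h T : ℝ} (H : ℝ → PathSp n h T → Euc n → ℝ) (cH : ℝ → ℝ)
    (σ : PathSp n h T → ℝ) (φ : ℝ → PathSp n h T → ℝ) : Prop :=
  UpperSol H cH σ φ ∧ LowerSol H cH σ φ

/-- `φ` is ci-differentiable at `(t,x(·))` with ci-derivatives `a = ∂ₜφ(t,x(·))`
and `g = ∇φ(t,x(·))`. -/
def HasCiDeriv {n : ℕ} {h T : ℝ} (φ : ℝ → PathSp n h T → ℝ)
    (t : ℝ) (x : PathSp n h T) (a : ℝ) (g : Euc n) : Prop :=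
  ∀ p ∈ ACPair t x, ∃ o : ℝ → ℝ,
    (∀ τ ∈ Set.Ioc t T,
      φ τ p.1 - φ t x =
        a * (τ - t) + @inner ℝ _ _ g (evalP p.1 τ - evalP x t) + o (τ - t)) ∧
    Tendsto (fun τ => o (τ - t) / (τ - t + ∫ ξ in t..τ, ‖p.2 ξ‖))
      (nhdsWithin t (Set.Ioi t)) (nhds 0)

/-- `φ ∈ Φ`, with the ci-derivatives `Dt = ∂ₜφ`, `Dx = ∇φ` and the full-measure
set `Eφ` of ci-differentiability made explicit. -/
structure IsInPhi {n : ℕ} {h T : ℝ} (φ : ℝ → PathSp n h T → ℝ)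
    (Dt : ℝ → PathSp n h T → ℝ) (Dx : ℝ → PathSp n h T → Euc n)
    (Eφ : Set ℝ) : Prop where
  cont : ContinuousOn (fun p : ℝ × PathSp n h T => φ p.1 p.2)
    (Set.Icc 0 T ×ˢ (Set.univ : Set (PathSp n h T)))
  absCont : ∀ t ∈ Set.Ico (0:ℝ) T, ∀ x : PathSp n h T, ∀ p ∈ ACPair t x,
    ∀ θ ∈ Set.Ioo t T, ∃ g : ℝ → ℝ, IntervalIntegrable g volume t θ ∧
      ∀ τ ∈ Set.Icc t θ, φ τ p.1 = φ t p.1 + ∫ ξ in t..τ, g ξ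
  Esub : Eφ ⊆ Set.Ico 0 T
  Efull : volume Eφ = ENNReal.ofReal T
  ciDiff : ∀ t ∈ Eφ, ∀ x : PathSp n h T, HasCiDeriv φ t x (Dt t x) (Dx t x)
  measD : ∀ x : PathSp n h T, Measurable (Eφ.restrict (fun t => (Dt t x, Dx t x)))
  contD : ∀ t ∈ Eφ, Continuous (fun x : PathSp n h T => (Dt t x, Dx t x))
  bddD : ∀ D : Set (PathSp n h T), IsCompact D → ∀ θ ∈ Set.Ico (0:ℝ) T,
    ∃ m : ℝ → ℝ, (IntegrableOn m (Set.Icc 0 θ) volume ∧ ∀ τ ∈ Set.Icc (0:ℝ) θ, 0 ≤ m τ) ∧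
      ∃ ℓ : ℝ, 0 < ℓ ∧ ∀ t ∈ Eφ ∩ Set.Icc 0 θ, ∀ x ∈ D, |Dt t x| ≤ m t ∧ ‖Dx t x‖ ≤ ℓ

/-- Semiclassical solution of the Cauchy problem (with derivative data). -/
def SemiclassicalSol {n : ℕ} {h T : ℝ} (H : ℝ → PathSp n h T → Euc n → ℝ)
    (σ : PathSp n h T → ℝ) (φ : ℝ → PathSp n h T → ℝ)
    (Dt : ℝ → PathSp n h T → ℝ) (Dx : ℝ → PathSp n h T → Euc n) (Eφ : Set ℝ) : Prop :=
  IsInPhi φ Dt Dx Eφ ∧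
  (∀ t ∈ Eφ, ∀ x : PathSp n h T, Dt t x + H t x (Dx t x) = 0) ∧
  ∀ x : PathSp n h T, φ T x = σ x

/-- The Steklov transform of `H` with respect to the first (time) variable,
with `H` extended by `0` outside `[0,T]`. -/
def steklov {n : ℕ} {h T : ℝ} (H : ℝ → PathSp n h T → Euc n → ℝ) (k : ℕ)
    (t : ℝ) (x : PathSp n h T) (s : Euc n) : ℝ :=
  ((k : ℝ) / 2) * ∫ τ in (t - (k : ℝ)⁻¹)..(t + (k : ℝ)⁻¹),
    (if τ ∈ Set.Icc (0:ℝ) T then H τ (stopPath t x) s else 0)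

/-! ### Differential game definitions -/

/-- Admissible controls with values in `P`. -/
def Ctrl {m : ℕ} (P : Set (Euc m)) : Set (ℝ → Euc m) :=
  {u | Measurable u ∧ ∀ τ, u τ ∈ P}

/-- Non-anticipative strategies mapping `Q`-valued controls to `P`-valued controls
on the interval `[t,T]`. -/
def NAStrat {mP mQ : ℕ} (P : Set (Euc mP)) (Q : Set (Euc mQ)) (t T : ℝ) :
    Set ((ℝ → Euc mQ) → ℝ → Euc mP) :=
  {α | (∀ v ∈ Ctrl Q, α v ∈ Ctrl P) ∧
    ∀ τ ∈ Set.Icc t T, ∀ v ∈ Ctrl Q, ∀ v' ∈ Ctrl Q,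
      (∀ᵐ ξ ∂(volume.restrict (Set.Icc t τ)), v ξ = v' ξ) →
      (∀ᵐ ξ ∂(volume.restrict (Set.Icc t τ)), α v ξ = α v' ξ)}

/-- `(y, y')` is (the derivative-witnessed) motion of the time-delay system
generated by `f` from `(t,x(·))` under controls `u(·)`, `v(·)`. -/
def IsMotion {n : ℕ} {h T : ℝ} {mP mQ : ℕ}
    (f : ℝ → PathSp n h T → Euc mP → Euc mQ → Euc n)
    (t : ℝ) (x : PathSp n h T) (u : ℝ → Euc mP) (v : ℝ → Euc mQ)
    (p : PathSp n h T × (ℝ → Euc n)) : Prop :=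
  p ∈ ACPair t x ∧
  ∀ᵐ τ ∂(volume.restrict (Set.Icc t T)), p.2 τ = f τ p.1 (u τ) (v τ)

/-- The set of values of the cost functional along motions (a singleton when
the motion exists and is unique). -/
def costVals {n : ℕ} {h T : ℝ} {mP mQ : ℕ}
    (f : ℝ → PathSp n h T → Euc mP → Euc mQ → Euc n)
    (χ : ℝ → PathSp n h T → Euc mP → Euc mQ → ℝ) (σ : PathSp n h T → ℝ)
    (t : ℝ) (x : PathSp n h T) (u : ℝ → Euc mP) (v : ℝ → Euc mQ) : Set ℝ :=
  {r | ∃ p : PathSp n h T × (ℝ → Euc n), IsMotion f t x u v p ∧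
        r = σ p.1 - ∫ τ in t..T, χ τ p.1 (u τ) (v τ)}

/-- The lower value `ρ⁻(t,x(·))` of the differential game. -/
def lowerValue {n : ℕ} {h T : ℝ} {mP mQ : ℕ} (P : Set (Euc mP)) (Q : Set (Euc mQ))
    (f : ℝ → PathSp n h T → Euc mP → Euc mQ → Euc n)
    (χ : ℝ → PathSp n h T → Euc mP → Euc mQ → ℝ) (σ : PathSp n h T → ℝ)
    (t : ℝ) (x : PathSp n h T) : ℝ :=
  sInf ((fun α => sSup (⋃ v ∈ Ctrl Q, costVals f χ σ t x (α v) v)) '' NAStrat P Q t T)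

/-- The upper value `ρ⁺(t,x(·))` of the differential game. -/
def upperValue {n : ℕ} {h T : ℝ} {mP mQ : ℕ} (P : Set (Euc mP)) (Q : Set (Euc mQ))
    (f : ℝ → PathSp n h T → Euc mP → Euc mQ → Euc n)
    (χ : ℝ → PathSp n h T → Euc mP → Euc mQ → ℝ) (σ : PathSp n h T → ℝ)
    (t : ℝ) (x : PathSp n h T) : ℝ :=
  sSup ((fun β => sInf (⋃ u ∈ Ctrl P, costVals f χ σ t x u (β u))) '' NAStrat Q P t T)

/-- The lower Hamiltonian `H⁻` (defined via the full-measure set `EC` from (C.2)). -/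
def Hlow {n : ℕ} {h T : ℝ} {mP mQ : ℕ} (P : Set (Euc mP)) (Q : Set (Euc mQ))
    (f : ℝ → PathSp n h T → Euc mP → Euc mQ → Euc n)
    (χ : ℝ → PathSp n h T → Euc mP → Euc mQ → ℝ) (EC : Set ℝ)
    (τ : ℝ) (y : PathSp n h T) (s : Euc n) : ℝ :=
  if τ ∈ EC then
    sSup ((fun v => sInf ((fun u => @inner ℝ _ _ s (f τ y u v) - χ τ y u v) '' P)) '' Q)
  else 0

/-- The upper Hamiltonian `H⁺` (defined via the full-measure set `EC` from (C.2)). -/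
def Hup {n : ℕ} {h T : ℝ} {mP mQ : ℕ} (P : Set (Euc mP)) (Q : Set (Euc mQ))
    (f : ℝ → PathSp n h T → Euc mP → Euc mQ → Euc n)
    (χ : ℝ → PathSp n h T → Euc mP → Euc mQ → ℝ) (EC : Set ℝ)
    (τ : ℝ) (y : PathSp n h T) (s : Euc n) : ℝ :=
  if τ ∈ EC then
    sInf ((fun u => sSup ((fun v => @inner ℝ _ _ s (f τ y u v) - χ τ y u v) '' Q)) '' P)
  else 0

/-- Assumption (C) on the data `(f, χ, σ)` of the differential game, with the
full-measure set `EC` from (C.2) and the function `c_f(·)` from (C.4) explicit. -/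
structure AssumpC {n : ℕ} {h T : ℝ} {mP mQ : ℕ} (P : Set (Euc mP)) (Q : Set (Euc mQ))
    (f : ℝ → PathSp n h T → Euc mP → Euc mQ → Euc n)
    (χ : ℝ → PathSp n h T → Euc mP → Euc mQ → ℝ)
    (σ : PathSp n h T → ℝ) (EC : Set ℝ) (cf : ℝ → ℝ) : Prop where
  meas : ∀ (y : PathSp n h T) (u : Euc mP) (v : Euc mQ),
    Measurable ((Set.Icc (0:ℝ) T).restrict (fun τ => (f τ y u v, χ τ y u v)))
  ECsub : EC ⊆ Set.Icc 0 T
  ECfull : volume EC = ENNReal.ofReal T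
  contOn : ∀ τ ∈ EC, ContinuousOn
    (fun p : PathSp n h T × Euc mP × Euc mQ => (f τ p.1 p.2.1 p.2.2, χ τ p.1 p.2.1 p.2.2))
    ((Set.univ : Set (PathSp n h T)) ×ˢ P ×ˢ Q)
  lip : ∀ D : Set (PathSp n h T), IsCompact D → ∃ lam : ℝ → ℝ, IntegNonneg T lam ∧
    ∃ E : Set ℝ, E ⊆ Set.Icc 0 T ∧ volume E = ENNReal.ofReal T ∧
      ∀ τ ∈ E, ∀ y₁ ∈ D, ∀ y₂ ∈ D, ∀ u ∈ P, ∀ v ∈ Q,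
        ‖f τ y₁ u v - f τ y₂ u v‖ + |χ τ y₁ u v - χ τ y₂ u v| ≤
          lam τ * ‖stopPath τ y₁ - stopPath τ y₂‖
  growth : IntegNonneg T cf ∧
    ∃ E : Set ℝ, E ⊆ Set.Icc 0 T ∧ volume E = ENNReal.ofReal T ∧
      ∀ τ ∈ E, ∀ y : PathSp n h T, ∀ u ∈ P, ∀ v ∈ Q,
        ‖f τ y u v‖ ≤ cf τ * (1 + ‖stopPath τ y‖)
  bdd : ∀ D : Set (PathSp n h T), IsCompact D → ∃ m : ℝ → ℝ, IntegNonneg T m ∧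
    ∃ E : Set ℝ, E ⊆ Set.Icc 0 T ∧ volume E = ENNReal.ofReal T ∧
      ∀ τ ∈ E, ∀ y ∈ D, ∀ u ∈ P, ∀ v ∈ Q, |χ τ y u v| ≤ m τ
  sigC : Continuous σ


section Paths
variable {n : ℕ} {h T : ℝ}

lemma cs_stopPath_apply (t : ℝ) (x : PathSp n h T) (σ : Set.Icc (-h) T) :
    stopPath t x σ = x (stopTime h T t σ) := rfl

lemma cs_stop_stop {a b : ℝ} (hab : a ≤ b) (x : PathSp n h T) :
    stopPath a (stopPath b x) = stopPath a x := by
  ext1 σ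
  simp only [cs_stopPath_apply]
  congr 1
  apply Subtype.ext
  simp only [stopTime]
  grind

lemma cs_stop_sub (a : ℝ) (x y : PathSp n h T) :
    stopPath a (x - y) = stopPath a x - stopPath a y := rfl

lemma cs_norm_stop_le (a : ℝ) (x : PathSp n h T) : ‖stopPath a x‖ ≤ ‖x‖ := by
  rw [ContinuousMap.norm_le _ (norm_nonneg _)]
  intro σ
  exact ContinuousMap.norm_coe_le_norm x _

lemma cs_stop_mono (x : PathSp n h T) : Monotone (fun a => ‖stopPath a x‖) := by
  intro a b hab
  simp only
  rw [← cs_stop_stop hab]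
  exact cs_norm_stop_le _ _

lemma cs_stop_eq_of_le {a b : ℝ} (hab : a ≤ b) {x y : PathSp n h T}
    (hxy : stopPath b x = stopPath b y) : stopPath a x = stopPath a y := by
  rw [← cs_stop_stop hab x, hxy, cs_stop_stop hab]

lemma cs_stop_T (x : PathSp n h T) : stopPath T x = x := by
  ext1 σ
  rw [cs_stopPath_apply]
  congr 1
  apply Subtype.ext
  have h1 := σ.2.1
  have h2 := σ.2.2
  simp only [stopTime]
  grind

lemma cs_evalP_of_mem (x : PathSp n h T) {τ : ℝ} (hτ : τ ∈ Set.Icc (-h) T) :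
    evalP x τ = x ⟨τ, hτ⟩ := by
  have hc : -h ≤ T := hτ.1.trans hτ.2
  simp only [evalP, dif_pos hc, Set.projIcc_of_mem hc hτ]

lemma cs_evalP_stop (x : PathSp n h T) {τ a : ℝ} (hτ : τ ∈ Set.Icc (-h) T) (ha : τ ≤ a) :
    evalP (stopPath a x) τ = evalP x τ := by
  rw [cs_evalP_of_mem _ hτ, cs_evalP_of_mem _ hτ, cs_stopPath_apply]
  congr 1
  apply Subtype.ext
  have h1 := hτ.1
  have h2 := hτ.2
  simp only [stopTime]
  grind

lemma cs_evalP_eq_of_stop {x y : PathSp n h T} {τ a : ℝ} (hτ : τ ∈ Set.Icc (-h) T) (ha : τ ≤ a)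
    (hxy : stopPath a x = stopPath a y) : evalP x τ = evalP y τ := by
  rw [← cs_evalP_stop x hτ ha, hxy, cs_evalP_stop y hτ ha]

lemma cs_norm_evalP_le (x : PathSp n h T) {τ : ℝ} (hτ : τ ∈ Set.Icc (-h) T) :
    ‖evalP x τ‖ ≤ ‖stopPath τ x‖ := by
  rw [← cs_evalP_stop x hτ le_rfl, cs_evalP_of_mem _ hτ]
  exact ContinuousMap.norm_coe_le_norm _ _

lemma cs_evalP_sub (x y : PathSp n h T) {τ : ℝ} (hτ : τ ∈ Set.Icc (-h) T) :
    evalP (x - y) τ = evalP x τ - evalP y τ := by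
  simp only [cs_evalP_of_mem _ hτ]; rfl

lemma cs_stop_grow (w : PathSp n h T) {a b ρ : ℝ} (ha : -h ≤ a) (hab : a ≤ b) (hb : b ≤ T)
    (H : ∀ ξ ∈ Set.Icc a b, ‖evalP w ξ - evalP w a‖ ≤ ρ) :
    ‖stopPath b w‖ ≤ max ‖stopPath a w‖ (‖evalP w a‖ + ρ) := by
  rw [ContinuousMap.norm_le _ (le_max_of_le_left (norm_nonneg _))]
  intro σ
  have h1 := σ.2.1
  have h2 := σ.2.2
  rw [cs_stopPath_apply]
  by_cases hs : σ.1 ≤ a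
  · apply le_max_of_le_left
    have : stopTime h T b σ = stopTime h T a σ := by
      apply Subtype.ext
      simp only [stopTime]
      grind
    rw [this, ← cs_stopPath_apply]
    exact ContinuousMap.norm_coe_le_norm _ _
  · apply le_max_of_le_right
    push Not at hs
    have hm : min σ.1 b ∈ Set.Icc a b := ⟨le_min hs.le hab, min_le_right _ _⟩
    have hm2 : min σ.1 b ∈ Set.Icc (-h) T := ⟨ha.trans hm.1, hm.2.trans hb⟩
    have : w (stopTime h T b σ) = evalP w (min σ.1 b) := by
      rw [cs_evalP_of_mem _ hm2]
      congr 1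
      apply Subtype.ext
      simp only [stopTime]
      exact max_eq_right hm2.1
    rw [this]
    have h3 := H _ hm
    have h4 := norm_add_le (evalP w a) (evalP w (min σ.1 b) - evalP w a)
    rw [add_sub_cancel] at h4
    linarith

lemma cs_compact (R : ℝ) (b : Set.Icc (-h) T → Set.Icc (-h) T → ℝ)
    (hb : ∀ s, Tendsto (b s) (𝓝 s) (𝓝 0)) (S : Set (PathSp n h T))
    (hS : ∀ y ∈ S, ‖y‖ ≤ R) (hS2 : ∀ y ∈ S, ∀ s r, ‖y s - y r‖ ≤ b s r) :
    ∃ D : Set (PathSp n h T), IsCompact D ∧ S ⊆ D := by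
  let e := ContinuousMap.equivBoundedOfCompact (Set.Icc (-h) T) (Euc n)
  have hcpt : IsCompact (closure (e '' S)) := by
    apply BoundedContinuousFunction.arzela_ascoli (Metric.closedBall (0 : Euc n) R)
      (isCompact_closedBall _ _)
    · rintro f σ ⟨y, hy, rfl⟩
      rw [mem_closedBall_zero_iff]
      exact (ContinuousMap.norm_coe_le_norm y σ).trans (hS y hy)
    · intro s
      apply Metric.equicontinuousAt_of_continuity_modulus (b s) (hb s)
      refine Eventually.of_forall fun r => ?_
      rintro ⟨f, y, hy, rfl⟩
      rw [dist_eq_norm]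
      exact hS2 y hy s r
  refine ⟨e.symm '' closure (e '' S), hcpt.image ?_, ?_⟩
  · exact (ContinuousMap.isometryEquivBoundedOfCompact (Set.Icc (-h) T) (Euc n)).symm.continuous
  · intro y hy
    exact ⟨e y, subset_closure ⟨y, hy, rfl⟩, e.symm_apply_apply y⟩

end Paths

section YFacts
variable {n : ℕ} {h T : ℝ}

lemma cs_ii {E : Type*} [NormedAddCommGroup E] {f : ℝ → E} {u v a b : ℝ}
    (hf : IntegrableOn f (Set.Icc u v)) (ha : u ≤ a) (hab : a ≤ b) (hb : b ≤ v) :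
    IntervalIntegrable f volume a b := by
  rw [intervalIntegrable_iff_integrableOn_Icc_of_le hab]
  exact hf.mono_set (Set.Icc_subset_Icc ha hb)

lemma cs_partition {c : ℝ → ℝ} {t : ℝ} (hc : IntegrableOn c (Set.Icc 0 T))
    (ht : t ∈ Set.Ico (0:ℝ) T) {η : ℝ} (hη : 0 < η) :
    ∃ N : ℕ, 0 < N ∧ ∀ k : ℕ, k < N →
      ∫ ξ in (t + k * ((T - t) / N))..(t + (k + 1 : ℕ) * ((T - t) / N)), c ξ ≤ η := by
  have hI : IntervalIntegrable c volume t T := cs_ii hc ht.1 ht.2.le le_rfl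
  have hcont : ContinuousOn (fun τ => ∫ ξ in t..τ, c ξ) (Set.Icc t T) := by
    have := intervalIntegral.continuousOn_primitive_interval (a := t) (b := T) (f := c)
      (μ := volume) (by rw [Set.uIcc_of_le ht.2.le]; exact hc.mono_set (Set.Icc_subset_Icc ht.1 le_rfl))
    rwa [Set.uIcc_of_le ht.2.le] at this
  have huc := isCompact_Icc.uniformContinuousOn_of_continuous hcont
  rw [Metric.uniformContinuousOn_iff] at huc
  obtain ⟨δ, hδ, H⟩ := huc η hη
  obtain ⟨N, hN⟩ := exists_nat_gt ((T - t) / δ)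
  have hTt : 0 < T - t := sub_pos.2 ht.2
  have hN0 : (0:ℝ) < N := lt_trans (div_pos hTt hδ) hN
  refine ⟨N, by exact_mod_cast hN0, fun k hk => ?_⟩
  have hd : 0 < (T - t) / N := div_pos hTt hN0
  have hdδ : (T - t) / N < δ := by
    rw [div_lt_iff₀ hN0]; rw [div_lt_iff₀ hδ] at hN; linarith
  have hNd : N * ((T - t) / N) = T - t := by field_simp
  have hk1 : ((k + 1 : ℕ) : ℝ) ≤ N := by exact_mod_cast hk
  have hmem : ∀ j : ℕ, (j : ℝ) ≤ N → t + j * ((T - t) / N) ∈ Set.Icc t T := by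
    intro j hj
    have h1 : (j : ℝ) * ((T - t) / N) ≤ N * ((T - t) / N) := by gcongr
    constructor
    · have : 0 ≤ (j : ℝ) * ((T - t) / N) := by positivity
      linarith
    · linarith
  have hka : (k : ℝ) ≤ N := by exact_mod_cast hk.le
  have m1 := hmem k hka
  have m2 := hmem (k + 1) hk1
  have h3 := H _ m2 _ m1 (by
    rw [Real.dist_eq]; push_cast
    rw [show t + ((k : ℝ) + 1) * ((T - t) / N) - (t + k * ((T - t) / N)) = (T - t) / N by ring,
      abs_of_pos hd]
    exact hdδ)
  rw [Real.dist_eq] at h3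
  rw [← intervalIntegral.integral_interval_sub_left (a := t)]
  · exact (le_abs_self _).trans h3.le
  · exact cs_ii hc ht.1 m2.1 m2.2
  · exact cs_ii hc ht.1 m1.1 m1.2

lemma cs_incr {t : ℝ} {x : PathSp n h T} {p : PathSp n h T × (ℝ → Euc n)}
    (hp : p ∈ ACPair t x) {a b : ℝ} (ha : t ≤ a) (hab : a ≤ b) (hb : b ≤ T) :
    IntervalIntegrable p.2 volume a b ∧ evalP p.1 b - evalP p.1 a = ∫ ξ in a..b, p.2 ξ := by
  obtain ⟨-, h2, h3⟩ := hp
  have hi : IntegrableOn p.2 (Set.Icc t T) :=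
    (intervalIntegrable_iff_integrableOn_Icc_of_le (ha.trans (hab.trans hb))).1 h2
  refine ⟨cs_ii hi ha hab hb, ?_⟩
  rw [h3 b ⟨ha.trans hab, hb⟩, h3 a ⟨ha, hab.trans hb⟩,
    ← intervalIntegral.integral_interval_sub_left (a := t) (cs_ii hi le_rfl (ha.trans hab) hb)
      (cs_ii hi le_rfl ha (hab.trans hb))]
  abel

lemma cs_incr_le {c : ℝ → ℝ} (hc : IntegNonneg T c) {t : ℝ} (ht0 : 0 ≤ t) {x : PathSp n h T}
    {p : PathSp n h T × (ℝ → Euc n)}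
    (hp : p ∈ YPair t x c) {a b : ℝ} (ha : t ≤ a) (hab : a ≤ b) (hb : b ≤ T) :
    ‖evalP p.1 b - evalP p.1 a‖ ≤ (1 + ‖stopPath b p.1‖) * ∫ ξ in a..b, c ξ := by
  obtain ⟨h1, h2⟩ := cs_incr hp.1 ha hab hb
  rw [h2, ← intervalIntegral.integral_const_mul]
  apply intervalIntegral.norm_integral_le_of_norm_le hab
  · have h3 := (ae_restrict_iff' measurableSet_Icc).1 hp.2
    filter_upwards [h3] with ξ hξ hm
    have hcξ : 0 ≤ c ξ := hc.2 ξ ⟨ht0.trans (ha.trans hm.1.le), hm.2.trans hb⟩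
    refine (hξ ⟨ha.trans hm.1.le, hm.2.trans hb⟩).trans ?_
    rw [mul_comm]
    have := cs_stop_mono p.1 hm.2
    simp only at this
    gcongr
  · exact (cs_ii hc.1 (ht0.trans ha) hab hb).const_mul _

lemma cs_bound {c : ℝ → ℝ} (hc : IntegNonneg T c) (hh : 0 ≤ h) {t : ℝ}
    (ht : t ∈ Set.Ico (0:ℝ) T) (x : PathSp n h T) :
    ∃ R : ℝ, 0 ≤ R ∧ ∀ p ∈ YPair t x c, ‖p.1‖ ≤ R := by
  obtain ⟨N, hN, hpart⟩ := cs_partition hc.1 ht (η := 1 / 2) (by norm_num)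
  have hN0 : (0:ℝ) < N := by exact_mod_cast hN
  have hTt : 0 < T - t := sub_pos.2 ht.2
  have hd : 0 < (T - t) / N := div_pos hTt hN0
  have hNd : N * ((T - t) / N) = T - t := by field_simp
  refine ⟨2 ^ N * (1 + ‖x‖), by positivity, fun p hp => ?_⟩
  have key : ∀ k : ℕ, k ≤ N →
      1 + ‖stopPath (t + k * ((T - t) / N)) p.1‖ ≤ 2 ^ k * (1 + ‖x‖) := by
    intro k
    induction k with
    | zero =>
      intro _
      simp only [Nat.cast_zero, zero_mul, add_zero, pow_zero, one_mul]
      rw [hp.1.1]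
      have := cs_norm_stop_le t x
      linarith
    | succ k ih =>
      intro hk
      have ih' := ih (by omega)
      have hpk := hpart k (by omega)
      set a := t + (k : ℝ) * ((T - t) / N) with ha
      set b := t + ((k + 1 : ℕ) : ℝ) * ((T - t) / N) with hb
      have hta : t ≤ a := by
        have : 0 ≤ (k : ℝ) * ((T - t) / N) := by positivity
        linarith
      have hab : a ≤ b := by
        rw [ha, hb]; push_cast; linarith
      have hk1 : ((k + 1 : ℕ) : ℝ) ≤ N := by exact_mod_cast hk
      have hbT : b ≤ T := by
        have h1 : ((k + 1 : ℕ) : ℝ) * ((T - t) / N) ≤ N * ((T - t) / N) := by gcongr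
        linarith
      have hg := cs_stop_grow p.1 (a := a) (b := b) (ρ := (1 + ‖stopPath b p.1‖) * (1 / 2))
        (by linarith [ht.1]) hab hbT (by
          intro ξ hξ
          have hle := cs_incr_le hc ht.1 hp hta hξ.1 (hξ.2.trans hbT)
          have hm := cs_stop_mono p.1 hξ.2
          simp only at hm
          have hi : ∫ r in a..ξ, c r ≤ 1 / 2 := by
            refine le_trans ?_ hpk
            apply intervalIntegral.integral_mono_interval le_rfl hξ.1 hξ.2
            · rw [EventuallyLE, ae_restrict_iff' measurableSet_Ioc]
              refine Eventually.of_forall fun r hr => ?_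
              exact hc.2 r ⟨by linarith [ht.1, hr.1], hr.2.trans hbT⟩
            · exact cs_ii hc.1 (ht.1.trans hta) hab hbT
          refine hle.trans ?_
          have : 0 ≤ 1 + ‖stopPath ξ p.1‖ := by positivity
          calc (1 + ‖stopPath ξ p.1‖) * ∫ r in a..ξ, c r
              ≤ (1 + ‖stopPath ξ p.1‖) * (1 / 2) := by gcongr
            _ ≤ _ := by gcongr)
      have he := cs_norm_evalP_le p.1 (τ := a) ⟨by linarith [ht.1], hab.trans hbT⟩
      rw [pow_succ]
      rcases le_max_iff.1 hg with h1 | h1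
      · nlinarith [norm_nonneg (stopPath a p.1)]
      · nlinarith [norm_nonneg (stopPath a p.1)]
  have := key N le_rfl
  rw [hNd, show t + (T - t) = T by ring, cs_stop_T] at this
  linarith

lemma cs_concat {c : ℝ → ℝ} {t a : ℝ} {x : PathSp n h T}
    (hh : 0 ≤ h) (ht0 : 0 ≤ t)
    {q p : PathSp n h T × (ℝ → Euc n)} (hq : q ∈ YPair t x c) (ha : t ≤ a) (haT : a ≤ T)
    (hp : p ∈ YPair a q.1 c) : p.1 ∈ YSet t x c := by
  classical
  have hqi : IntegrableOn q.2 (Set.Icc t T) :=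
    (intervalIntegrable_iff_integrableOn_Icc_of_le (ha.trans haT)).1 hq.1.2.1
  have hpi : IntegrableOn p.2 (Set.Icc a T) :=
    (intervalIntegrable_iff_integrableOn_Icc_of_le haT).1 hp.1.2.1
  let f : ℝ → Euc n := fun ξ => if ξ ≤ a then q.2 ξ else p.2 ξ
  have hf1 : ∀ u v, t ≤ u → u ≤ v → v ≤ a →
      IntervalIntegrable f volume u v ∧ ∫ ξ in u..v, f ξ = ∫ ξ in u..v, q.2 ξ := by
    intro u v hu huv hv
    have heq : Set.EqOn q.2 f (Set.uIoc u v) := by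
      intro ξ hξ
      rw [Set.uIoc_of_le huv] at hξ
      simp only [f, if_pos (hξ.2.trans hv)]
    refine ⟨(cs_ii hqi hu huv (hv.trans haT)).congr heq, ?_⟩
    apply intervalIntegral.integral_congr_ae
    exact Eventually.of_forall fun ξ hξ => (heq hξ).symm
  have hf2 : ∀ v, a ≤ v → v ≤ T →
      IntervalIntegrable f volume a v ∧ ∫ ξ in a..v, f ξ = ∫ ξ in a..v, p.2 ξ := by
    intro v hav hv
    have heq : Set.EqOn p.2 f (Set.uIoc a v) := by
      intro ξ hξ
      rw [Set.uIoc_of_le hav] at hξ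
      simp only [f, if_neg (not_le.2 hξ.1)]
    refine ⟨(cs_ii hpi le_rfl hav hv).congr heq, ?_⟩
    apply intervalIntegral.integral_congr_ae
    exact Eventually.of_forall fun ξ hξ => (heq hξ).symm
  have hev : ∀ τ ∈ Set.Icc t a, evalP p.1 τ = evalP q.1 τ := fun τ hτ =>
    cs_evalP_eq_of_stop ⟨by linarith [hτ.1], hτ.2.trans haT⟩ hτ.2 hp.1.1
  refine ⟨f, ⟨⟨?_, ?_, ?_⟩, ?_⟩⟩
  · exact (cs_stop_eq_of_le ha hp.1.1).trans hq.1.1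
  · exact (hf1 t a le_rfl ha le_rfl).1.trans (hf2 T haT le_rfl).1
  · intro τ hτ
    simp only
    rcases le_total τ a with hτa | hτa
    · rw [(hf1 t τ le_rfl hτ.1 hτa).2, hev τ ⟨hτ.1, hτa⟩, hev t ⟨le_rfl, ha⟩]
      exact hq.1.2.2 τ hτ
    · rw [← intervalIntegral.integral_add_adjacent_intervals (hf1 t a le_rfl ha le_rfl).1
        (hf2 τ hτa hτ.2).1, (hf1 t a le_rfl ha le_rfl).2, (hf2 τ hτa hτ.2).2,
        hp.1.2.2 τ ⟨hτa, hτ.2⟩, hev a ⟨ha, le_rfl⟩, hq.1.2.2 a ⟨ha, haT⟩, hev t ⟨le_rfl, ha⟩]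
      abel
  · have h1 := (ae_restrict_iff' measurableSet_Icc).1 hq.2
    have h2 := (ae_restrict_iff' measurableSet_Icc).1 hp.2
    rw [ae_restrict_iff' measurableSet_Icc]
    filter_upwards [h1, h2] with ξ hξ1 hξ2 hξ
    simp only [f]
    split_ifs with hle
    · rw [cs_stop_eq_of_le hle hp.1.1]
      exact hξ1 hξ
    · exact hξ2 ⟨(not_le.1 hle).le, hξ.2⟩

lemma cs_YPair_mono {c c' : ℝ → ℝ} {t : ℝ} (ht0 : 0 ≤ t) {x : PathSp n h T}
    (hcc : ∀ τ ∈ Set.Icc (0:ℝ) T, c τ ≤ c' τ) {p : PathSp n h T × (ℝ → Euc n)}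
    (hp : p ∈ YPair t x c) : p ∈ YPair t x c' := by
  refine ⟨hp.1, ?_⟩
  have h1 := (ae_restrict_iff' measurableSet_Icc).1 hp.2
  rw [ae_restrict_iff' measurableSet_Icc]
  filter_upwards [h1] with ξ hξ1 hξ
  refine (hξ1 hξ).trans ?_
  have := hcc ξ ⟨ht0.trans hξ.1, hξ.2⟩
  gcongr

lemma cs_Y_compact {c : ℝ → ℝ} (hc : IntegNonneg T c) (hh : 0 ≤ h) {t : ℝ}
    (ht : t ∈ Set.Ico (0:ℝ) T) (x : PathSp n h T) :
    ∃ D : Set (PathSp n h T), IsCompact D ∧ YSet t x c ⊆ D := by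
  obtain ⟨R, hR0, hR⟩ := cs_bound hc hh ht x
  have hcont : ContinuousOn (fun τ => ∫ ξ in t..τ, c ξ) (Set.Icc t T) := by
    have := intervalIntegral.continuousOn_primitive_interval (a := t) (b := T) (f := c)
      (μ := volume) (by
        rw [Set.uIcc_of_le ht.2.le]; exact hc.1.mono_set (Set.Icc_subset_Icc ht.1 le_rfl))
    rwa [Set.uIcc_of_le ht.2.le] at this
  let G : Set.Icc (-h) T → ℝ := fun s => ∫ ξ in t..(max s.1 t), c ξ
  have hG : Continuous G := by
    refine hcont.comp_continuous (f := fun s : Set.Icc (-h) T => max s.1 t)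
      (continuous_subtype_val.max continuous_const) ?_
    exact fun s => ⟨le_max_right _ _, max_le s.2.2 ht.2.le⟩
  refine cs_compact R
    (fun s r => ‖stopPath t x s - stopPath t x r‖ + (1 + R) * |G s - G r|) ?_ _ ?_ ?_
  · intro s
    have : Continuous (fun r => ‖stopPath t x s - stopPath t x r‖ + (1 + R) * |G s - G r|) := by
      fun_prop
    have h0 := this.tendsto s
    simpa using h0
  · rintro y ⟨y', hy⟩
    exact hR (y, y') hy
  · rintro y ⟨y', hy⟩
    have hdec : ∀ s : Set.Icc (-h) T,
        y s = stopPath t x s + (evalP y (max s.1 t) - evalP y t) := by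
      intro s
      have hm : max s.1 t ∈ Set.Icc (-h) T := ⟨s.2.1.trans (le_max_left _ _), max_le s.2.2 ht.2.le⟩
      have hx : stopPath t y = stopPath t x := hy.1.1
      rw [← hx, cs_stopPath_apply]
      rcases le_total s.1 t with hst | hst
      · rw [max_eq_right hst, sub_self, add_zero]
        congr 1
        apply Subtype.ext
        simp only [stopTime]
        rw [min_eq_left hst, max_eq_right s.2.1]
      · rw [cs_evalP_of_mem y hm, cs_evalP_of_mem y ⟨by linarith [ht.1], ht.2.le⟩]
        have e1 : stopTime h T t s = ⟨t, by linarith [ht.1], ht.2.le⟩ := by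
          apply Subtype.ext
          simp only [stopTime]
          rw [min_eq_right hst, max_eq_right (by linarith [ht.1])]
        have e2 : (⟨max s.1 t, hm⟩ : Set.Icc (-h) T) = s := Subtype.ext (max_eq_left hst)
        rw [e1, e2]
        abel
    have hinc : ∀ u v, t ≤ u → u ≤ v → v ≤ T → ‖evalP y v - evalP y u‖ ≤
        (1 + R) * |(∫ ξ in t..v, c ξ) - ∫ ξ in t..u, c ξ| := by
      intro u v hu huv hv
      rw [intervalIntegral.integral_interval_sub_left (cs_ii hc.1 ht.1 (hu.trans huv) hv)
        (cs_ii hc.1 ht.1 hu (huv.trans hv))]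
      refine (cs_incr_le (p := (y, y')) hc ht.1 hy hu huv hv).trans ?_
      have h1 : ‖stopPath v y‖ ≤ R := (cs_norm_stop_le _ _).trans (hR (y, y') hy)
      have h2 := le_abs_self (∫ ξ in u..v, c ξ)
      have h3 : (0:ℝ) ≤ 1 + ‖stopPath v y‖ := by positivity
      calc (1 + ‖stopPath v y‖) * ∫ ξ in u..v, c ξ
          ≤ (1 + ‖stopPath v y‖) * |∫ ξ in u..v, c ξ| := by gcongr
        _ ≤ _ := by gcongr
    intro s r
    rw [hdec s, hdec r]
    have e : stopPath t x s + (evalP y (max s.1 t) - evalP y t) -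
        (stopPath t x r + (evalP y (max r.1 t) - evalP y t)) =
        (stopPath t x s - stopPath t x r) + (evalP y (max s.1 t) - evalP y (max r.1 t)) := by abel
    rw [e]
    refine (norm_add_le _ _).trans ?_
    gcongr
    rcases le_total (max s.1 t) (max r.1 t) with hl | hl
    · rw [norm_sub_rev, abs_sub_comm]
      exact hinc _ _ (le_max_right _ _) hl (max_le r.2.2 ht.2.le)
    · exact hinc _ _ (le_max_right _ _) hl (max_le s.2.2 ht.2.le)

end YFacts

section HamFacts
variable {n : ℕ} {h T : ℝ}

lemma cs_full {f g : ℝ → ℝ} {a b : ℝ} {E : Set ℝ}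
    (hf : AEMeasurable f (volume.restrict (Set.Icc a b)))
    (hg : AEMeasurable g (volume.restrict (Set.Icc a b))) (hE : E ⊆ Set.Icc a b)
    (hv : volume E = ENNReal.ofReal (b - a)) (hfg : ∀ τ ∈ E, f τ ≤ g τ) :
    ∀ᵐ τ ∂(volume.restrict (Set.Icc a b)), f τ ≤ g τ := by
  rw [ae_iff_measure_eq (nullMeasurableSet_le hf hg)]
  apply le_antisymm (measure_mono (Set.subset_univ _))
  rw [Measure.restrict_apply_univ, Real.volume_Icc, ← hv]
  rw [Measure.restrict_apply' measurableSet_Icc]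
  exact measure_mono fun τ hτ => ⟨hfg τ hτ, hE hτ⟩

lemma cs_H_meas {H : ℝ → PathSp n h T → Euc n → ℝ} (hH : CondA1 H) (y : PathSp n h T)
    (s : Euc n) : AEMeasurable (fun ξ => H ξ y s) (volume.restrict (Set.Icc 0 T)) :=
  aemeasurable_restrict_of_measurable_subtype measurableSet_Icc (hH y s)

lemma cs_stop_meas (w : PathSp n h T) : Measurable (fun a : ℝ => ‖stopPath a w‖) :=
  (cs_stop_mono w).measurable

lemma cs_H_int {H : ℝ → PathSp n h T → Euc n → ℝ} {c : ℝ → ℝ} (hH : CondA H c)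
    (y : PathSp n h T) (s : Euc n) :
    IntegrableOn (fun ξ => H ξ y s) (Set.Icc 0 T) := by
  obtain ⟨hA1, -, -, ⟨hc, E4, hE4, hv4, hA4⟩, hA5⟩ := hH
  obtain ⟨m, hm, hm5⟩ := hA5 {y} isCompact_singleton
  obtain ⟨E5, hE5, hv5, hb5⟩ := hm5 y rfl
  have hs := cs_H_meas hA1 y s
  have h0 := cs_H_meas hA1 y 0
  have b5 := cs_full (f := fun ξ => |H ξ y 0|) (g := m) (a := 0) (b := T)
    (continuous_abs.measurable.comp_aemeasurable h0) hm.1.aemeasurable hE5 (by simpa using hv5) hb5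
  have b4 := cs_full (f := fun ξ => |H ξ y s - H ξ y 0|)
    (g := fun ξ => c ξ * (1 + ‖stopPath ξ y‖) * ‖s - 0‖) (a := 0) (b := T)
    (continuous_abs.measurable.comp_aemeasurable (hs.sub h0))
    ((hc.1.aemeasurable.mul ((cs_stop_meas y).const_add 1).aemeasurable).mul_const _)
    hE4 (by simpa using hv4) (fun τ hτ => hA4 τ hτ y s 0)
  have hbd : IntegrableOn (fun ξ => m ξ + c ξ * ((1 + ‖y‖) * ‖s - 0‖)) (Set.Icc 0 T) :=
    hm.1.add (hc.1.mul_const _)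
  refine Integrable.mono' hbd hs.aestronglyMeasurable ?_
  filter_upwards [b5, b4, ae_restrict_mem measurableSet_Icc] with ξ h5 h4 hξ
  rw [Real.norm_eq_abs]
  have e1 : |H ξ y s| ≤ |H ξ y s - H ξ y 0| + |H ξ y 0| := by
    have := abs_add_le (H ξ y s - H ξ y 0) (H ξ y 0)
    rwa [sub_add_cancel] at this
  have e2 : c ξ * (1 + ‖stopPath ξ y‖) * ‖s - 0‖ ≤ c ξ * ((1 + ‖y‖) * ‖s - 0‖) := by
    rw [mul_assoc]
    have := hc.2 ξ hξ
    have := cs_norm_stop_le ξ y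
    gcongr
  linarith

/-- One step of the construction. -/
lemma cs_step (hh : 0 ≤ h)
    {H₁ H₂ : ℝ → PathSp n h T → Euc n → ℝ} {c₁ c₂ : ℝ → ℝ}
    (hH₁ : CondA H₁ c₁) (hH₂ : CondA H₂ c₂)
    {φ₁ φ₂ : ℝ → PathSp n h T → ℝ}
    (h₁ : PropU H₁ c₁ φ₁) (h₂ : PropL H₂ c₂ φ₂)
    {t : ℝ} (ht : t ∈ Set.Ico (0:ℝ) T) {x : PathSp n h T}
    (hcmp : ∀ y ∈ YSet t x c₁, ∃ E : Set ℝ, E ⊆ Set.Icc t T ∧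
      volume E = ENNReal.ofReal (T - t) ∧
      ∀ τ ∈ E, ∀ s : Euc n, H₂ τ y s ≤ H₁ τ y s)
    {D : Set (PathSp n h T)} (hD1 : YSet t x c₁ ⊆ D) (hD2 : YSet t x c₂ ⊆ D)
    {lam : ℝ → ℝ} (hlam : CondA3For H₂ D lam)
    {a b : ℝ} (hta : t ≤ a) (hab : a < b) (hbT : b ≤ T) (s : Euc n)
    {y₁ y₂ : PathSp n h T} (hy₁ : y₁ ∈ YSet t x c₁) (hy₂ : y₂ ∈ YSet t x c₂) :
    ∃ z₁ ∈ YSet t x c₁, ∃ z₂ ∈ YSet t x c₂, stopPath a z₁ = stopPath a y₁ ∧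
      stopPath a z₂ = stopPath a y₂ ∧
      φ₁ b z₁ - φ₂ b z₂ ≤ φ₁ a y₁ - φ₂ a y₂ +
        @inner ℝ _ _ s (evalP (z₁ - z₂) b - evalP (z₁ - z₂) a) +
        (∫ ξ in a..b, lam ξ) * ((1 + ‖s‖) * ‖stopPath b (z₁ - z₂)‖) := by
  obtain ⟨y₁', hy₁'⟩ := hy₁
  obtain ⟨y₂', hy₂'⟩ := hy₂
  have ha0 : 0 ≤ a := ht.1.trans hta
  have haT : a < T := hab.trans_le hbT
  obtain ⟨p₁, hp₁, hU⟩ := h₁ a ⟨ha0, haT⟩ y₁ s b ⟨hab, hbT⟩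
  obtain ⟨p₂, hp₂, hL⟩ := h₂ a ⟨ha0, haT⟩ y₂ s b ⟨hab, hbT⟩
  have hz₁ : p₁.1 ∈ YSet t x c₁ := cs_concat (q := (y₁, y₁')) hh ht.1 hy₁' hta haT.le hp₁
  have hz₂ : p₂.1 ∈ YSet t x c₂ := cs_concat (q := (y₂, y₂')) hh ht.1 hy₂' hta haT.le hp₂
  refine ⟨p₁.1, hz₁, p₂.1, hz₂, hp₁.1.1, hp₂.1.1, ?_⟩
  obtain ⟨i₁, e₁⟩ := cs_incr hp₁.1 le_rfl hab.le hbT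
  obtain ⟨i₂, e₂⟩ := cs_incr hp₂.1 le_rfl hab.le hbT
  have I₁ := cs_H_int hH₁ p₁.1 s
  have I₂₁ := cs_H_int hH₂ p₁.1 s
  have I₂₂ := cs_H_int hH₂ p₂.1 s
  have J₁ := cs_ii I₁ ha0 hab.le hbT
  have J₂₂ := cs_ii I₂₂ ha0 hab.le hbT
  have inner_int : ∀ {f : ℝ → Euc n}, IntervalIntegrable f volume a b →
      IntervalIntegrable (fun ξ => @inner ℝ _ _ s (f ξ)) volume a b ∧
      ∫ ξ in a..b, @inner ℝ _ _ s (f ξ) = @inner ℝ _ _ s (∫ ξ in a..b, f ξ) := by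
    intro f hf
    constructor
    · rw [intervalIntegrable_iff] at hf ⊢
      exact hf.const_inner s
    · exact (innerSL ℝ s).intervalIntegral_comp_comm hf
  rw [intervalIntegral.integral_sub (inner_int i₁).1 J₁, (inner_int i₁).2, ← e₁] at hU
  rw [intervalIntegral.integral_sub (inner_int i₂).1 J₂₂, (inner_int i₂).2, ← e₂] at hL
  -- the Hamiltonian estimate
  obtain ⟨E, hE, hvE, hEle⟩ := hcmp p₁.1 hz₁
  have hsub : Set.Icc t T ⊆ Set.Icc 0 T := Set.Icc_subset_Icc ht.1 le_rfl
  have c1 := cs_full (f := fun ξ => H₂ ξ p₁.1 s) (g := fun ξ => H₁ ξ p₁.1 s)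
    (I₂₁.mono_set hsub).aemeasurable (I₁.mono_set hsub).aemeasurable hE hvE
    (fun τ hτ => hEle τ hτ s)
  obtain ⟨hlamI, hA3⟩ := hlam
  obtain ⟨E3, hE3, hv3, hb3⟩ := hA3 p₁.1 (hD1 hz₁) p₂.1 (hD2 hz₂) s
  have c2 := cs_full (f := fun ξ => |H₂ ξ p₁.1 s - H₂ ξ p₂.1 s|)
    (g := fun ξ => lam ξ * (1 + ‖s‖) * ‖stopPath ξ (p₁.1 - p₂.1)‖) (a := 0) (b := T)
    (continuous_abs.measurable.comp_aemeasurable (I₂₁.aemeasurable.sub I₂₂.aemeasurable))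
    ((hlamI.1.aemeasurable.mul_const _).mul (cs_stop_meas _).aemeasurable)
    hE3 (by simpa using hv3) hb3
  have hHle : ∫ ξ in a..b, (H₂ ξ p₂.1 s - H₁ ξ p₁.1 s) ≤
      ∫ ξ in a..b, lam ξ * ((1 + ‖s‖) * ‖stopPath b (p₁.1 - p₂.1)‖) := by
    apply intervalIntegral.integral_mono_ae_restrict hab.le (J₂₂.sub J₁)
      ((cs_ii hlamI.1 ha0 hab.le hbT).mul_const _)
    rw [EventuallyLE, ae_restrict_iff' measurableSet_Icc]
    filter_upwards [(ae_restrict_iff' measurableSet_Icc).1 c1,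
      (ae_restrict_iff' measurableSet_Icc).1 c2] with ξ h1 h2 hξ
    have g1 := h1 ⟨hta.trans hξ.1, hξ.2.trans hbT⟩
    have hξ0 : ξ ∈ Set.Icc 0 T := ⟨ha0.trans hξ.1, hξ.2.trans hbT⟩
    have g2 := (abs_le.1 (h2 hξ0)).1
    have hl := hlamI.2 ξ hξ0
    have hm := cs_stop_mono (p₁.1 - p₂.1) hξ.2
    simp only at hm
    have g3 : lam ξ * (1 + ‖s‖) * ‖stopPath ξ (p₁.1 - p₂.1)‖ ≤
        lam ξ * ((1 + ‖s‖) * ‖stopPath b (p₁.1 - p₂.1)‖) := by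
      rw [mul_assoc]; gcongr
    linarith
  rw [intervalIntegral.integral_sub J₂₂ J₁, intervalIntegral.integral_mul_const] at hHle
  rw [cs_evalP_sub _ _ ⟨by linarith, hbT⟩, cs_evalP_sub _ _ ⟨by linarith, haT.le⟩]
  have hin : @inner ℝ _ _ s (evalP p₁.1 b - evalP p₂.1 b - (evalP p₁.1 a - evalP p₂.1 a)) =
      @inner ℝ _ _ s (evalP p₁.1 b - evalP p₁.1 a) -
      @inner ℝ _ _ s (evalP p₂.1 b - evalP p₂.1 a) := by
    rw [← inner_sub_right]; congr 1; abel
  rw [hin]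
  linarith

/-- The Lyapunov-type function. -/
def csF (m : ℝ) (a : Euc n) : ℝ := (m ^ 2 - ‖a‖ ^ 2) ^ 2 + (‖a‖ ^ 2) ^ 2

/-- Its gradient in the second variable. -/
def csG (m : ℝ) (a : Euc n) : Euc n := (8 * ‖a‖ ^ 2 - 4 * m ^ 2) • a

lemma csF_ge (m : ℝ) (a : Euc n) : m ^ 4 ≤ 2 * csF m a := by
  unfold csF
  nlinarith [sq_nonneg (m ^ 2 - ‖a‖ ^ 2 - ‖a‖ ^ 2)]

lemma csG_le {m : ℝ} {a : Euc n} (ha : ‖a‖ ≤ m) : ‖csG m a‖ ≤ 4 * m ^ 3 := by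
  have h0 := norm_nonneg a
  have hm : 0 ≤ m := h0.trans ha
  have h2 : ‖a‖ ^ 2 ≤ m ^ 2 := by gcongr
  rw [csG, norm_smul, Real.norm_eq_abs]
  have : |8 * ‖a‖ ^ 2 - 4 * m ^ 2| ≤ 4 * m ^ 2 := by
    rw [abs_le]; constructor <;> nlinarith [sq_nonneg ‖a‖]
  calc _ ≤ 4 * m ^ 2 * m := by gcongr
    _ = _ := by ring

lemma csF_step {m m' ρ R : ℝ} {a a' : Euc n} (ha : ‖a‖ ≤ m) (ha' : ‖a'‖ ≤ m') (hmm : m ≤ m')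
    (hR : m' ≤ R) (hρ : ‖a' - a‖ ≤ ρ) (hgrow : m' ≤ max m (‖a‖ + ρ)) :
    csF m' a' ≤ csF m a + @inner ℝ _ _ (csG m a) (a' - a) + 28 * R ^ 2 * ρ ^ 2 := by
  have h0 := norm_nonneg a
  have h0' := norm_nonneg a'
  have hρ0 : 0 ≤ ρ := (norm_nonneg _).trans hρ
  have hm : 0 ≤ m := h0.trans ha
  have hR0 : 0 ≤ R := by linarith
  have hd1 : ‖a'‖ - ‖a‖ ≤ ρ := (norm_sub_norm_le _ _).trans hρ
  have hd2 : ‖a‖ - ‖a'‖ ≤ ρ := by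
    have := norm_sub_norm_le a a'
    rw [norm_sub_rev] at this
    linarith
  -- first part
  have hin : @inner ℝ _ _ (csG m a) (a' - a) =
      (8 * ‖a‖ ^ 2 - 4 * m ^ 2) * @inner ℝ _ _ a (a' - a) := by
    rw [csG, real_inner_smul_left]
  have hsq : ‖a'‖ ^ 2 = ‖a‖ ^ 2 + 2 * @inner ℝ _ _ a (a' - a) + ‖a' - a‖ ^ 2 := by
    have := norm_add_sq_real a (a' - a)
    rwa [add_sub_cancel] at this
  have hq : ‖a' - a‖ ^ 2 ≤ ρ ^ 2 := by gcongr
  have hq0 : 0 ≤ ‖a' - a‖ ^ 2 := by positivity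
  have hr : ‖a‖ ^ 2 ≤ R ^ 2 := by gcongr; linarith
  have hz : (‖a'‖ ^ 2 - ‖a‖ ^ 2) ^ 2 ≤ 4 * R ^ 2 * ρ ^ 2 := by
    have e : (‖a'‖ ^ 2 - ‖a‖ ^ 2) ^ 2 = (‖a'‖ + ‖a‖) ^ 2 * (‖a'‖ - ‖a‖) ^ 2 := by ring
    have e1 : (‖a'‖ + ‖a‖) ^ 2 ≤ (2 * R) ^ 2 := by gcongr; linarith
    have e2 : (‖a'‖ - ‖a‖) ^ 2 ≤ ρ ^ 2 := by
      apply sq_le_sq'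
      · linarith
      · exact hd1
    rw [e]
    calc _ ≤ (2 * R) ^ 2 * ρ ^ 2 := by gcongr
      _ = _ := by ring
  have first : csF m a' ≤ csF m a + @inner ℝ _ _ (csG m a) (a' - a) + 12 * R ^ 2 * ρ ^ 2 := by
    rw [hin]
    unfold csF
    set u := @inner ℝ _ _ a (a' - a)
    set q := ‖a' - a‖ ^ 2
    set r := ‖a‖ ^ 2
    have hz' : (2 * u + q) ^ 2 ≤ 4 * R ^ 2 * ρ ^ 2 := by
      have : ‖a'‖ ^ 2 - r = 2 * u + q := by rw [hsq]; ring
      rwa [this] at hz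
    rw [hsq]
    have hrq : r * q ≤ R ^ 2 * ρ ^ 2 := by gcongr
    have hmq : 0 ≤ m ^ 2 * q := by positivity
    nlinarith
  have second : csF m' a' ≤ csF m a' + 16 * R ^ 2 * ρ ^ 2 := by
    unfold csF
    rcases le_max_iff.1 hgrow with hg | hg
    · have : m' = m := le_antisymm hg hmm
      rw [this]
      have : 0 ≤ 16 * R ^ 2 * ρ ^ 2 := by positivity
      linarith
    · have A : m' ^ 2 - m ^ 2 ≤ 2 * R * ρ := by
        have e : m' ^ 2 - m ^ 2 = (m' + m) * (m' - m) := by ring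
        rw [e]
        have : 0 ≤ m' - m := by linarith
        have : m' - m ≤ ρ := by linarith
        have : m' + m ≤ 2 * R := by linarith
        gcongr
      have A0 : 0 ≤ m' ^ 2 - m ^ 2 := by
        have : m ^ 2 ≤ m' ^ 2 := by gcongr
        linarith
      have B : m' ^ 2 - ‖a'‖ ^ 2 ≤ 4 * R * ρ := by
        have e : m' ^ 2 - ‖a'‖ ^ 2 = (m' + ‖a'‖) * (m' - ‖a'‖) := by ring
        rw [e]
        have h1 : 0 ≤ m' - ‖a'‖ := by linarith
        have h2 : m' - ‖a'‖ ≤ 2 * ρ := by linarith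
        have h3 : m' + ‖a'‖ ≤ 2 * R := by linarith
        calc _ ≤ (2 * R) * (2 * ρ) := by gcongr
          _ = _ := by ring
      have e : (m' ^ 2 - ‖a'‖ ^ 2) ^ 2 - (m ^ 2 - ‖a'‖ ^ 2) ^ 2 =
          (m' ^ 2 - m ^ 2) * ((m' ^ 2 - ‖a'‖ ^ 2) + (m ^ 2 - ‖a'‖ ^ 2)) := by ring
      have hC : (m' ^ 2 - m ^ 2) * ((m' ^ 2 - ‖a'‖ ^ 2) + (m ^ 2 - ‖a'‖ ^ 2)) ≤
          (2 * R * ρ) * (8 * R * ρ) := by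
        calc _ ≤ (m' ^ 2 - m ^ 2) * (8 * R * ρ) := by
              apply mul_le_mul_of_nonneg_left _ A0
              linarith
          _ ≤ _ := by gcongr
      nlinarith
  linarith

end HamFacts

section Final
variable {n : ℕ} {h T : ℝ}

lemma cs_numeric {ε δ αm α α' Λ m m' ρ R F F' I s κ₁ P P' : ℝ}
    (hδ : 0 < δ) (hαm : 0 < αm) (hε : ε = δ ^ 3 * αm) (hε1 : ε ≤ 1)
    (hα' : αm ≤ α') (hα'1 : α' ≤ 1) (hαα : α' * (1 + 10 * Λ) ≤ α) (hΛ : 0 ≤ Λ)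
    (hm : 0 ≤ m) (hmR : m ≤ R) (hm' : m' ≤ m + ρ) (hρ : 0 ≤ ρ) (hF : m ^ 4 ≤ 2 * F)
    (hs0 : 0 ≤ s) (hs : ε * s ≤ α' * (4 * m ^ 3)) (hκ : 0 ≤ κ₁)
    (hF' : F' ≤ F + I + κ₁)
    (hP : ε * P' ≤ ε * P - α' * I + Λ * ((ε + ε * s) * m')) :
    ε * P' + α' * F' ≤ ε * P + α * F + Λ * (δ ^ 4 + (1 + 4 * R ^ 3) * ρ) + κ₁ := by
  have hα0 : 0 < α' := hαm.trans_le hα'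
  have hε0 : 0 < ε := by rw [hε]; positivity
  have hm4 : 0 ≤ m ^ 4 := by positivity
  have hF0 : 0 ≤ F := by linarith
  have y1 : δ ^ 3 * m ≤ δ ^ 4 + m ^ 4 := by
    rcases le_total m δ with hle | hle
    · have : δ ^ 3 * m ≤ δ ^ 3 * δ := by gcongr
      nlinarith
    · have : δ ^ 3 * m ≤ m ^ 3 * m := by gcongr
      have : 0 ≤ δ ^ 4 := by positivity
      nlinarith
  have y2 : ε * m ≤ δ ^ 4 + α' * m ^ 4 := by
    have e1 : ε * m = αm * (δ ^ 3 * m) := by rw [hε]; ring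
    have e2 : αm * (δ ^ 3 * m) ≤ α' * (δ ^ 4 + m ^ 4) := by gcongr
    have e3 : α' * δ ^ 4 ≤ 1 * δ ^ 4 := by gcongr
    nlinarith
  have y3 : (ε + ε * s) * m' ≤ (ε + α' * (4 * m ^ 3)) * (m + ρ) := by
    have : 0 ≤ ε * s := by positivity
    calc (ε + ε * s) * m' ≤ (ε + ε * s) * (m + ρ) := by gcongr
      _ ≤ _ := by gcongr
  have y4 : (ε + α' * (4 * m ^ 3)) * ρ ≤ (1 + 4 * R ^ 3) * ρ := by
    have : α' * (4 * m ^ 3) ≤ 1 * (4 * R ^ 3) := by gcongr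
    apply mul_le_mul_of_nonneg_right _ hρ
    linarith
  have y5 : (ε + ε * s) * m' ≤ (δ ^ 4 + (1 + 4 * R ^ 3) * ρ) + 10 * (α' * F) := by
    have : α' * m ^ 4 ≤ α' * (2 * F) := by gcongr
    nlinarith
  have y6 : Λ * ((ε + ε * s) * m') ≤ Λ * ((δ ^ 4 + (1 + 4 * R ^ 3) * ρ) + 10 * (α' * F)) := by
    gcongr
  have y7 : α' * (1 + 10 * Λ) * F ≤ α * F := by gcongr
  have y8 : α' * F' ≤ α' * (F + I + κ₁) := by gcongr
  have y9 : α' * κ₁ ≤ 1 * κ₁ := by gcongr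
  nlinarith

lemma cs_construct (hh : 0 ≤ h)
    {H₁ H₂ : ℝ → PathSp n h T → Euc n → ℝ} {c₁ c₂ : ℝ → ℝ}
    (hH₁ : CondA H₁ c₁) (hH₂ : CondA H₂ c₂)
    {φ₁ φ₂ : ℝ → PathSp n h T → ℝ}
    (h₁ : PropU H₁ c₁ φ₁) (h₂ : PropL H₂ c₂ φ₂)
    (hna₁ : NonAnticipative φ₁) (hna₂ : NonAnticipative φ₂)
    {t : ℝ} (ht : t ∈ Set.Ico (0:ℝ) T) {x : PathSp n h T}
    (hcmp : ∀ y ∈ YSet t x c₁, ∃ E : Set ℝ, E ⊆ Set.Icc t T ∧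
      volume E = ENNReal.ofReal (T - t) ∧
      ∀ τ ∈ E, ∀ s : Euc n, H₂ τ y s ≤ H₁ τ y s)
    {D : Set (PathSp n h T)} (hD1 : YSet t x c₁ ⊆ D) (hD2 : YSet t x c₂ ⊆ D)
    {lam : ℝ → ℝ} (hlam : CondA3For H₂ D lam) {δ : ℝ} (hδ : 0 < δ) (hδ1 : δ ≤ 1) :
    ∃ z₁ ∈ YSet t x c₁, ∃ z₂ ∈ YSet t x c₂,
      φ₁ T z₁ - φ₂ T z₂ + ‖z₁ - z₂‖ ^ 4 / (2 * δ ^ 3) ≤ φ₁ t x - φ₂ t x +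
        ((∫ ξ in t..T, lam ξ) + 1) * δ / Real.exp (-(10 * ∫ ξ in t..T, lam ξ)) := by
  have hc₁ : IntegNonneg T c₁ := hH₁.2.2.2.1.1
  have hc₂ : IntegNonneg T c₂ := hH₂.2.2.2.1.1
  set c : ℝ → ℝ := fun τ => c₁ τ + c₂ τ with hcdef
  have hc : IntegNonneg T c :=
    ⟨hc₁.1.add hc₂.1, fun τ hτ => add_nonneg (hc₁.2 τ hτ) (hc₂.2 τ hτ)⟩
  have hcle₁ : ∀ τ ∈ Set.Icc (0:ℝ) T, c₁ τ ≤ c τ := fun τ hτ => by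
    have := hc₂.2 τ hτ
    simp only [hcdef]; linarith
  have hcle₂ : ∀ τ ∈ Set.Icc (0:ℝ) T, c₂ τ ≤ c τ := fun τ hτ => by
    have := hc₁.2 τ hτ
    simp only [hcdef]; linarith
  have hY : ∀ y, y ∈ YSet t x c₁ ∨ y ∈ YSet t x c₂ → y ∈ YSet t x c := by
    rintro y (⟨y', hy⟩ | ⟨y', hy⟩)
    · exact ⟨y', cs_YPair_mono ht.1 hcle₁ hy⟩
    · exact ⟨y', cs_YPair_mono ht.1 hcle₂ hy⟩
  obtain ⟨R₀, hR₀, hbd⟩ := cs_bound hc hh ht x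
  have hbdY : ∀ y ∈ YSet t x c, ‖y‖ ≤ R₀ := by
    rintro y ⟨y', hy⟩
    exact hbd (y, y') hy
  have hincY : ∀ y ∈ YSet t x c, ∀ a b, t ≤ a → a ≤ b → b ≤ T →
      ‖evalP y b - evalP y a‖ ≤ (1 + R₀) * ∫ ξ in a..b, c ξ := by
    rintro y ⟨y', hy⟩ a b hta hab hbT
    refine (cs_incr_le (p := (y, y')) hc ht.1 hy hta hab hbT).trans ?_
    have h1 : ‖stopPath b y‖ ≤ R₀ := (cs_norm_stop_le _ _).trans (hbd (y, y') hy)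
    have h2 : 0 ≤ ∫ ξ in a..b, c ξ :=
      intervalIntegral.integral_nonneg hab fun ξ hξ =>
        hc.2 ξ ⟨ht.1.trans (hta.trans hξ.1), hξ.2.trans hbT⟩
    gcongr
  have hl := hlam.1
  set L := ∫ ξ in t..T, lam ξ with hL
  set Q := ∫ ξ in t..T, c ξ with hQ
  have nonneg_of : ∀ {f : ℝ → ℝ}, IntegNonneg T f → ∀ a b, t ≤ a → a ≤ b → b ≤ T →
      0 ≤ ∫ ξ in a..b, f ξ := by
    intro f hf a b hta hab hbT
    exact intervalIntegral.integral_nonneg hab fun ξ hξ =>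
        hf.2 ξ ⟨ht.1.trans (hta.trans hξ.1), hξ.2.trans hbT⟩
  have split_of : ∀ {f : ℝ → ℝ}, IntegNonneg T f → ∀ a b, t ≤ a → a ≤ b → b ≤ T →
      ∫ ξ in t..b, f ξ = (∫ ξ in t..a, f ξ) + ∫ ξ in a..b, f ξ := by
    intro f hf a b hta hab hbT
    exact (intervalIntegral.integral_add_adjacent_intervals
      (cs_ii hf.1 ht.1 hta (hab.trans hbT)) (cs_ii hf.1 (ht.1.trans hta) hab hbT)).symm
  have hL0 : 0 ≤ L := nonneg_of hl t T le_rfl ht.2.le le_rfl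
  have hQ0 : 0 ≤ Q := nonneg_of hc t T le_rfl ht.2.le le_rfl
  set R := 2 * R₀ with hR
  set κ := 2 * (1 + R₀) with hκ
  have hR0 : 0 ≤ R := by positivity
  have hκ0 : 0 ≤ κ := by positivity
  set αm := Real.exp (-(10 * L)) with hαm
  have hαm0 : 0 < αm := Real.exp_pos _
  have hαm1 : αm ≤ 1 := Real.exp_le_one_iff.2 (by linarith)
  set ε := δ ^ 3 * αm with hε
  have hε0 : 0 < ε := by positivity
  have hε1 : ε ≤ 1 := by
    have : δ ^ 3 ≤ 1 := pow_le_one₀ hδ.le hδ1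
    calc ε ≤ 1 * 1 := by rw [hε]; gcongr
      _ = 1 := by ring
  set Z := 1 + (1 + 4 * R ^ 3) * κ * L + 28 * R ^ 2 * κ ^ 2 * Q with hZ
  have hZ0 : 0 < Z := by positivity
  set η := δ ^ 4 / Z with hη
  have hη0 : 0 < η := by positivity
  set A := δ ^ 4 + (1 + 4 * R ^ 3) * κ * η with hA
  set B := 28 * R ^ 2 * κ ^ 2 * η with hB
  let α : ℝ → ℝ := fun τ => Real.exp (-(10 * ∫ ξ in t..τ, lam ξ))
  obtain ⟨N, hN, hpart⟩ := cs_partition hc.1 ht hη0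
  have hN0 : (0:ℝ) < N := by exact_mod_cast hN
  have hTt : 0 < T - t := sub_pos.2 ht.2
  have hd : 0 < (T - t) / N := div_pos hTt hN0
  have hNd : N * ((T - t) / N) = T - t := by field_simp
  have key : ∀ k : ℕ, k ≤ N → ∃ z₁ ∈ YSet t x c₁, ∃ z₂ ∈ YSet t x c₂,
      ∀ τ, τ = t + k * ((T - t) / N) →
      ε * (φ₁ τ z₁ - φ₂ τ z₂) +
        α τ * csF ‖stopPath τ (z₁ - z₂)‖ (evalP (z₁ - z₂) τ) ≤
      ε * (φ₁ t x - φ₂ t x) + A * (∫ ξ in t..τ, lam ξ) + B * ∫ ξ in t..τ, c ξ := by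
    intro k
    induction k with
    | zero =>
      intro _
      have htI : t ∈ Set.Icc (-h) T := ⟨by linarith [ht.1], ht.2.le⟩
      have htI0 : t ∈ Set.Icc 0 T := ⟨ht.1, ht.2.le⟩
      obtain ⟨p₁, hp₁, -⟩ := h₁ t ht x 0 T ⟨ht.2, le_rfl⟩
      obtain ⟨p₂, hp₂, -⟩ := h₂ t ht x 0 T ⟨ht.2, le_rfl⟩
      refine ⟨p₁.1, ⟨p₁.2, hp₁⟩, p₂.1, ⟨p₂.2, hp₂⟩, ?_⟩
      intro τ hτ
      have hτ' : τ = t := by rw [hτ]; simp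
      subst hτ'
      have e0 : stopPath τ (p₁.1 - p₂.1) = 0 := by
        rw [cs_stop_sub, hp₁.1.1, hp₂.1.1, sub_self]
      have e1 : evalP (p₁.1 - p₂.1) τ = 0 := by
        have := cs_norm_evalP_le (p₁.1 - p₂.1) htI
        rw [e0, norm_zero] at this
        exact norm_le_zero_iff.1 this
      rw [hna₁ τ htI0 p₁.1, hna₂ τ htI0 p₂.1, hp₁.1.1, hp₂.1.1, ← hna₁ τ htI0, ← hna₂ τ htI0,
        e0, e1]
      simp [csF]
    | succ k ih =>
      intro hk
      obtain ⟨y₁, hy₁, y₂, hy₂, ih'⟩ := ih (by omega)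
      have hpk := hpart k (by omega)
      have ih' := ih' _ rfl
      set a := t + (k : ℝ) * ((T - t) / N) with ha
      set b := t + ((k + 1 : ℕ) : ℝ) * ((T - t) / N) with hb
      have hta : t ≤ a := by
        have : 0 ≤ (k : ℝ) * ((T - t) / N) := by positivity
        linarith
      have hab : a < b := by
        rw [ha, hb]; push_cast; linarith
      have hk1 : ((k + 1 : ℕ) : ℝ) ≤ N := by exact_mod_cast hk
      have hbT : b ≤ T := by
        have h1 : ((k + 1 : ℕ) : ℝ) * ((T - t) / N) ≤ N * ((T - t) / N) := by gcongr
        linarith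
      have haI : a ∈ Set.Icc (-h) T := ⟨by linarith [ht.1], hab.le.trans hbT⟩
      have hbI : b ∈ Set.Icc (-h) T := ⟨by linarith [ht.1], hbT⟩
      set m := ‖stopPath a (y₁ - y₂)‖ with hm
      set v := evalP (y₁ - y₂) a with hv
      obtain ⟨z₁, hz₁, z₂, hz₂, hs₁, hs₂, hstep⟩ := cs_step hh hH₁ hH₂ h₁ h₂ ht hcmp hD1 hD2 hlam
        hta hab hbT (-(α b / ε) • csG m v) hy₁ hy₂
      refine ⟨z₁, hz₁, z₂, hz₂, ?_⟩
      rintro τ rfl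
      have hsw : stopPath a (z₁ - z₂) = stopPath a (y₁ - y₂) := by
        rw [cs_stop_sub, cs_stop_sub, hs₁, hs₂]
      have hva : evalP (z₁ - z₂) a = v := cs_evalP_eq_of_stop haI le_rfl hsw
      set Λ := ∫ ξ in a..b, lam ξ with hΛ
      set I := ∫ ξ in a..b, c ξ with hI
      have hΛ0 : 0 ≤ Λ := nonneg_of hl a b hta hab.le hbT
      have hI0 : 0 ≤ I := nonneg_of hc a b hta hab.le hbT
      have hwinc : ∀ ξ ∈ Set.Icc a b, ‖evalP (z₁ - z₂) ξ - evalP (z₁ - z₂) a‖ ≤ κ * I := by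
        intro ξ hξ
        have hξI : ξ ∈ Set.Icc (-h) T := ⟨haI.1.trans hξ.1, hξ.2.trans hbT⟩
        rw [cs_evalP_sub _ _ hξI, cs_evalP_sub _ _ haI]
        have e : evalP z₁ ξ - evalP z₂ ξ - (evalP z₁ a - evalP z₂ a) =
          (evalP z₁ ξ - evalP z₁ a) - (evalP z₂ ξ - evalP z₂ a) := by abel
        rw [e]
        refine (norm_sub_le _ _).trans ?_
        have i1 := hincY z₁ (hY _ (Or.inl hz₁)) a ξ hta hξ.1 hξI.2
        have i2 := hincY z₂ (hY _ (Or.inr hz₂)) a ξ hta hξ.1 hξI.2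
        have i3 : ∫ r in a..ξ, c r ≤ I := by
          have s1 := split_of hc a ξ hta hξ.1 hξI.2
          have s2 := split_of hc a b hta hab.le hbT
          have s3 := split_of hc ξ b (hta.trans hξ.1) hξ.2 hbT
          have s4 := nonneg_of hc ξ b (hta.trans hξ.1) hξ.2 hbT
          linarith
        have i4 : (1 + R₀) * ∫ r in a..ξ, c r ≤ (1 + R₀) * I := by gcongr
        rw [hκ]; linarith
      have hgrow := cs_stop_grow (z₁ - z₂) haI.1 hab.le hbT hwinc
      rw [hsw, hva] at hgrow
      set m' := ‖stopPath b (z₁ - z₂)‖ with hm'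
      set v' := evalP (z₁ - z₂) b with hv'
      have hvm : ‖v‖ ≤ m := cs_norm_evalP_le _ haI
      have hvm' : ‖v'‖ ≤ m' := cs_norm_evalP_le _ hbI
      have hmm : m ≤ m' := by
        have := cs_stop_mono (z₁ - z₂) hab.le
        simp only [hsw] at this
        exact this
      have hm'R : m' ≤ R := by
        refine (cs_norm_stop_le _ _).trans ((norm_sub_le _ _).trans ?_)
        have i1 := hbdY z₁ (hY _ (Or.inl hz₁))
        have i2 := hbdY z₂ (hY _ (Or.inr hz₂))
        rw [hR]; linarith
      have hvv : ‖v' - v‖ ≤ κ * I := by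
        have := hwinc b ⟨hab.le, le_rfl⟩
        rwa [hva] at this
      have hFs := csF_step hvm hvm' hmm hm'R hvv hgrow
      have hκI : 0 ≤ κ * I := by positivity
      have hm'm : m' ≤ m + κ * I := by
        rcases le_max_iff.1 hgrow with hg | hg <;> linarith
      have hα0 : 0 < α b := Real.exp_pos _
      have hnorm : ε * ‖-(α b / ε) • csG m v‖ = α b * ‖csG m v‖ := by
        rw [neg_smul, norm_neg, norm_smul, Real.norm_eq_abs, abs_of_pos (by positivity)]
        field_simp
      have hinn : ε * @inner ℝ _ _ (-(α b / ε) • csG m v) (v' - v) =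
          -(α b * @inner ℝ _ _ (csG m v) (v' - v)) := by
        rw [real_inner_smul_left]
        field_simp
      rw [hva] at hstep
      have hsa := split_of hl a b hta hab.le hbT
      have hsc := split_of hc a b hta hab.le hbT
      have hαα : α b * (1 + 10 * Λ) ≤ α a := by
        have e : α a = α b * Real.exp (10 * Λ) := by
          simp only [α]
          rw [← Real.exp_add, hsa]
          congr 1; ring
        rw [e]
        have := Real.add_one_le_exp (10 * Λ)
        gcongr
        linarith
      have hαlow : αm ≤ α b := by
        apply Real.exp_le_exp.2
        have s3 := split_of hl b T (hta.trans hab.le) hbT le_rfl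
        have s4 := nonneg_of hl b T (hta.trans hab.le) hbT le_rfl
        linarith
      have hα1 : α b ≤ 1 := by
        apply Real.exp_le_one_iff.2
        have s4 := nonneg_of hl t b le_rfl (hta.trans hab.le) hbT
        linarith
      have hnum := cs_numeric (ε := ε) (δ := δ) (αm := αm) (α := α a) (α' := α b) (Λ := Λ)
        (m := m) (m' := m') (ρ := κ * I) (R := R) (F := csF m v) (F' := csF m' v')
        (I := @inner ℝ _ _ (csG m v) (v' - v)) (s := ‖-(α b / ε) • csG m v‖)
        (κ₁ := 28 * R ^ 2 * (κ * I) ^ 2) (P := φ₁ a y₁ - φ₂ a y₂) (P' := φ₁ b z₁ - φ₂ b z₂)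
        hδ hαm0 hε hε1 hαlow hα1 hαα hΛ0 (norm_nonneg _) (hmm.trans hm'R) hm'm hκI
        (csF_ge _ _) (norm_nonneg _)
        (by rw [hnorm]; have := csG_le hvm; gcongr) (by positivity) hFs
        (by
          have := mul_le_mul_of_nonneg_left hstep hε0.le
          rw [mul_add, mul_add, hinn] at this
          refine this.trans (le_of_eq ?_)
          ring)
      have f1 : Λ * (δ ^ 4 + (1 + 4 * R ^ 3) * (κ * I)) ≤ A * Λ := by
        rw [hA, mul_comm, ← mul_assoc]
        gcongr
      have f2 : 28 * R ^ 2 * (κ * I) ^ 2 ≤ B * I := by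
        have : 28 * R ^ 2 * (κ * I) ^ 2 = 28 * R ^ 2 * κ ^ 2 * I * I := by ring
        rw [this, hB]
        gcongr
      rw [hsa, hsc]
      linarith
  obtain ⟨z₁, hz₁, z₂, hz₂, hfin⟩ := key N le_rfl
  refine ⟨z₁, hz₁, z₂, hz₂, ?_⟩
  have hfin := hfin T (by rw [hNd]; ring)
  rw [cs_stop_T] at hfin
  have hge := csF_ge ‖z₁ - z₂‖ (evalP (z₁ - z₂) T)
  have hAB : A * L + B * Q ≤ (L + 1) * δ ^ 4 := by
    have e : A * L + B * Q = L * δ ^ 4 + ((Z - 1) / Z) * δ ^ 4 := by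
      rw [hA, hB, hη, hZ]; ring
    have e2 : (Z - 1) / Z ≤ 1 := by rw [div_le_one hZ0]; linarith
    have : (Z - 1) / Z * δ ^ 4 ≤ 1 * δ ^ 4 := by gcongr
    rw [e]; linarith
  have hαT : α T = αm := rfl
  rw [hαT] at hfin
  have h5 : αm * (‖z₁ - z₂‖ ^ 4 / 2) ≤ αm * csF ‖z₁ - z₂‖ (evalP (z₁ - z₂) T) := by
    gcongr; linarith
  have h6 : ε * (φ₁ T z₁ - φ₂ T z₂ + ‖z₁ - z₂‖ ^ 4 / (2 * δ ^ 3)) ≤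
      ε * (φ₁ t x - φ₂ t x + (L + 1) * δ / αm) := by
    have e1 : ε * (‖z₁ - z₂‖ ^ 4 / (2 * δ ^ 3)) = αm * (‖z₁ - z₂‖ ^ 4 / 2) := by
      rw [hε]; field_simp
    have e2 : ε * ((L + 1) * δ / αm) = (L + 1) * δ ^ 4 := by
      rw [hε]; field_simp
    rw [mul_add, mul_add, e1, e2]
    linarith
  exact le_of_mul_le_mul_left h6 hε0

end Final

/-- symmetric comparison principle: if `H₁ ≥ H₂` a.e. on
`[t,T]` along every `y(·) ∈ Y(t,x(·);c_{H₁}(·))`, then an upper solution for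
`H₁` dominates a lower solution for `H₂` at `(t,x(·))`. -/
theorem stmt11 {n : ℕ} {h T : ℝ} (hT : 0 < T) (hh : 0 ≤ h)
    (H₁ H₂ : ℝ → PathSp n h T → Euc n → ℝ) (c₁ c₂ : ℝ → ℝ)
    (hH₁ : CondA H₁ c₁) (hH₂ : CondA H₂ c₂)
    (σ : PathSp n h T → ℝ) (hσ : Continuous σ)
    (φ₁ φ₂ : ℝ → PathSp n h T → ℝ)
    (h₁ : UpperSol H₁ c₁ σ φ₁) (h₂ : LowerSol H₂ c₂ σ φ₂)
    (t : ℝ) (ht : t ∈ Set.Ico (0:ℝ) T) (x : PathSp n h T)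
    (hcmp : ∀ y ∈ YSet t x c₁, ∃ E : Set ℝ, E ⊆ Set.Icc t T ∧
      volume E = ENNReal.ofReal (T - t) ∧
      ∀ τ ∈ E, ∀ s : Euc n, H₂ τ y s ≤ H₁ τ y s) :
    φ₂ t x ≤ φ₁ t x := by
  obtain ⟨hna₁, -, hT₁, hU⟩ := h₁
  obtain ⟨hna₂, -, hT₂, hL⟩ := h₂
  have hc₁ : IntegNonneg T c₁ := hH₁.2.2.2.1.1
  have hc₂ : IntegNonneg T c₂ := hH₂.2.2.2.1.1
  obtain ⟨D₁, hD₁c, hD₁⟩ := cs_Y_compact hc₁ hh ht x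
  obtain ⟨D₂, hD₂c, hD₂⟩ := cs_Y_compact hc₂ hh ht x
  have hD : IsCompact (D₁ ∪ D₂) := hD₁c.union hD₂c
  obtain ⟨lam, hlam⟩ := hH₂.2.2.1 _ hD
  by_contra hcon
  push Not at hcon
  obtain ⟨S, hS⟩ := hD.exists_bound_of_continuousOn hσ.continuousOn
  have huc := hD.uniformContinuousOn_of_continuous hσ.continuousOn
  rw [Metric.uniformContinuousOn_iff] at huc
  set θ := φ₂ t x - φ₁ t x with hθ
  have hθ0 : 0 < θ := sub_pos.2 hcon
  obtain ⟨r, hr, hunif⟩ := huc (θ / 2) (by linarith)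
  set L := ∫ ξ in t..T, lam ξ with hLd
  have hL0 : 0 ≤ L := intervalIntegral.integral_nonneg ht.2.le fun ξ hξ =>
    hlam.1.2 ξ ⟨ht.1.trans hξ.1, hξ.2⟩
  set αm := Real.exp (-(10 * L)) with hαm
  have hαm0 : 0 < αm := Real.exp_pos _
  have hS1 : 0 < 4 * |S| + 1 := by positivity
  set δ := min 1 (min (θ / 2 * αm / (L + 1)) (r ^ 4 / (4 * |S| + 1))) with hδd
  have hδ0 : 0 < δ := by
    apply lt_min one_pos
    apply lt_min <;> positivity
  have hδ1 : δ ≤ 1 := min_le_left _ _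
  have hδ2 : δ ≤ θ / 2 * αm / (L + 1) := (min_le_right _ _).trans (min_le_left _ _)
  have hδ3 : δ ≤ r ^ 4 / (4 * |S| + 1) := (min_le_right _ _).trans (min_le_right _ _)
  obtain ⟨z₁, hz₁, z₂, hz₂, hfin⟩ := cs_construct hh hH₁ hH₂ hU hL hna₁ hna₂ ht hcmp
    (hD₁.trans Set.subset_union_left) (hD₂.trans Set.subset_union_right) hlam hδ0 hδ1
  have m1 : z₁ ∈ D₁ ∪ D₂ := Or.inl (hD₁ hz₁)
  have m2 : z₂ ∈ D₁ ∪ D₂ := Or.inr (hD₂ hz₂)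
  have hsm : (L + 1) * δ / αm ≤ θ / 2 := by
    rw [le_div_iff₀ (by linarith)] at hδ2
    rw [div_le_iff₀ hαm0]
    linarith
  have hσ1 := hT₁ z₁
  have hσ2 := hT₂ z₂
  have hmain : σ z₁ - σ z₂ + ‖z₁ - z₂‖ ^ 4 / (2 * δ ^ 3) ≤ -(θ / 2) := by
    have : φ₁ t x - φ₂ t x = -θ := by rw [hθ]; ring
    linarith
  have hpos : 0 ≤ ‖z₁ - z₂‖ ^ 4 / (2 * δ ^ 3) := by positivity
  have b1 := abs_le.1 ((hS z₁ m1).trans (le_abs_self S))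
  have b2 := abs_le.1 ((hS z₂ m2).trans (le_abs_self S))
  have hq : ‖z₁ - z₂‖ ^ 4 / (2 * δ ^ 3) < 2 * |S| := by linarith [b1.1, b2.2]
  have hq2 : ‖z₁ - z₂‖ ^ 4 < r ^ 4 := by
    rw [div_lt_iff₀ (by positivity)] at hq
    rw [le_div_iff₀ hS1] at hδ3
    have hδ4 : δ ^ 3 ≤ δ := pow_le_of_le_one hδ0.le hδ1 (by norm_num)
    have : 4 * |S| * δ ^ 3 ≤ 4 * |S| * δ := by gcongr
    linarith
  have hq3 : ‖z₁ - z₂‖ < r := lt_of_pow_lt_pow_left₀ 4 hr.le hq2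
  have hd := hunif z₁ m1 z₂ m2 (by rwa [dist_eq_norm])
  rw [Real.dist_eq] at hd
  have := (abs_lt.1 hd).1
  linarith

end
end

section
/- Suppose Hamiltonians H₁ and H₂ satisfy conditions (A.1)–(A.5) and σ : C → ℝ satisfies (A.6). Let φ₁ be a minimax solution of the Cauchy problem with Hamiltonian H₁, let φ₂ be a minimax solution of the Cauchy problem with Hamiltonian H₂ (both with boundary functional σ), and fix (t,x(·)) ∈ [0,T) × C. Suppose that for every y(·) ∈ Y(t,x(·);c_{H₁}(·)) there exists a set E = E(y(·)) ⊂ [t,T] with μ(E) = T − t such that H₁(τ,y(·),s) = H₂(τ,y(·),s) for all τ ∈ E and s ∈ ℝⁿ. Then φ₁(t,x(·)) = φ₂(t,x(·)). -/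
open MeasureTheory Set Filter Topology

noncomputable section

attribute [local instance] Classical.propDecidable

lemma evalP_coe {n : ℕ} {h T : ℝ} (x : PathSp n h T) (τ : Set.Icc (-h) T) :
    evalP x τ.1 = x τ := by
  have hc : -h ≤ T := τ.2.1.trans τ.2.2
  rw [evalP, dif_pos hc, Set.projIcc_val]

lemma stopPath_apply {n : ℕ} {h T : ℝ} (t : ℝ) (x : PathSp n h T) (τ : Set.Icc (-h) T) :
    stopPath t x τ = evalP x (max (-h) (min τ.1 t)) := by
  exact (evalP_coe x (stopTime h T t τ)).symm

lemma evalP_sub {n : ℕ} {h T : ℝ} (x y : PathSp n h T) (τ : ℝ) :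
    evalP (x - y) τ = evalP x τ - evalP y τ := by
  unfold evalP; split_ifs <;> simp

lemma stopPath_sub {n : ℕ} {h T : ℝ} (x y : PathSp n h T) (τ : ℝ) :
    stopPath τ (x - y) = stopPath τ x - stopPath τ y := by
  ext1 ξ; rfl

lemma evalP_continuous {n : ℕ} {h T : ℝ} (x : PathSp n h T) : Continuous (evalP x) := by
  unfold evalP
  split_ifs with hc
  · exact x.continuous.comp continuous_projIcc
  · exact continuous_const

lemma norm_stop_le_iff {n : ℕ} {h T τ M : ℝ} (hτ : τ ∈ Set.Icc (-h) T) (hM : 0 ≤ M)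
    (y : PathSp n h T) :
    ‖stopPath τ y‖ ≤ M ↔ ∀ ξ ∈ Set.Icc (-h) τ, ‖evalP y ξ‖ ≤ M := by
  rw [ContinuousMap.norm_le _ hM]
  constructor
  · intro H ξ hξ
    have := H ⟨ξ, hξ.1, hξ.2.trans hτ.2⟩
    rw [stopPath_apply] at this
    simpa [min_eq_left hξ.2, max_eq_right hξ.1] using this
  · intro H ξ
    rw [stopPath_apply]
    exact H _ ⟨le_max_left _ _, max_le hτ.1 (min_le_right _ _)⟩

lemma norm_eval_le_stopped {n : ℕ} {h T τ ξ : ℝ} (hτ : τ ∈ Set.Icc (-h) T) (hξ : ξ ∈ Set.Icc (-h) τ)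
    (y : PathSp n h T) : ‖evalP y ξ‖ ≤ ‖stopPath τ y‖ :=
  (norm_stop_le_iff hτ (norm_nonneg _) y).1 le_rfl ξ hξ

lemma norm_stop_le {n : ℕ} {h T : ℝ} (τ : ℝ) (y : PathSp n h T) : ‖stopPath τ y‖ ≤ ‖y‖ := by
  rw [ContinuousMap.norm_le _ (norm_nonneg _)]
  intro ξ
  exact y.norm_coe_le_norm _

lemma stopPath_T {n : ℕ} {h T : ℝ} (y : PathSp n h T) : stopPath T y = y := by
  ext1 ξ
  rw [stopPath_apply, min_eq_left ξ.2.2, max_eq_right ξ.2.1, evalP_coe]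

lemma norm_stop_mono {n : ℕ} {h T : ℝ} (y : PathSp n h T) :
    Monotone (fun τ => ‖stopPath τ y‖) := by
  intro a b hab
  show ‖stopPath a y‖ ≤ ‖stopPath b y‖
  rw [ContinuousMap.norm_le _ (norm_nonneg _)]
  intro ξ
  have h1 : stopPath a y ξ = stopPath b y (stopTime h T a ξ) := by
    rw [stopPath_apply, stopPath_apply]
    congr 1
    have : (stopTime h T a ξ).1 = max (-h) (min ξ.1 a) := rfl
    rw [this]
    rcases le_total (-h) b with hb | hb
    · have : max (-h) (min ξ.1 a) ≤ b := max_le hb ((min_le_right _ _).trans hab)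
      rw [min_eq_left this]
      simp
    · rw [max_eq_left ((min_le_right _ _).trans (hab.trans hb)),
        max_eq_left (min_le_right _ _ |>.trans hb)]
  rw [h1]
  exact ContinuousMap.norm_coe_le_norm _ _

lemma evalP_eq_of_stopped {n : ℕ} {h T t ξ : ℝ} {x y : PathSp n h T} (ht : t ≤ T)
    (hs : stopPath t y = stopPath t x) (hξ : ξ ∈ Set.Icc (-h) t) : evalP y ξ = evalP x ξ := by
  have := congrArg (fun z : PathSp n h T => z ⟨ξ, hξ.1, hξ.2.trans ht⟩) hs
  simp only [stopPath_apply] at this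
  simpa [min_eq_left hξ.2, max_eq_right hξ.1] using this

lemma stop_eq_of_evalP {n : ℕ} {h T t : ℝ} {x y : PathSp n h T} (ht : -h ≤ t)
    (hs : ∀ ξ ∈ Set.Icc (-h) t, evalP y ξ = evalP x ξ) : stopPath t y = stopPath t x := by
  ext1 ξ
  rw [stopPath_apply, stopPath_apply]
  exact hs _ ⟨le_max_left _ _, max_le ht (min_le_right _ _)⟩

lemma stop_eq_mono {n : ℕ} {h T a b : ℝ} {x y : PathSp n h T} (ha : -h ≤ a) (hab : a ≤ b)
    (hb : b ≤ T) (hs : stopPath b y = stopPath b x) : stopPath a y = stopPath a x :=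
  stop_eq_of_evalP ha fun _ hξ => evalP_eq_of_stopped hb hs ⟨hξ.1, hξ.2.trans hab⟩

lemma ypair_concat {n : ℕ} {h T t τ : ℝ} {x : PathSp n h T} {c : ℝ → ℝ}
    (hh : 0 ≤ h) (ht : 0 ≤ t) (htτ : t ≤ τ) (hτT : τ ≤ T)
    {p q : PathSp n h T × (ℝ → Euc n)} (hp : p ∈ YPair t x c) (hq : q ∈ YPair τ p.1 c) :
    (q.1, fun ξ => if ξ ≤ τ then p.2 ξ else q.2 ξ) ∈ YPair t x c := by
  obtain ⟨⟨hp1, hp2, hp3⟩, hp4⟩ := hp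
  obtain ⟨⟨hq1, hq2, hq3⟩, hq4⟩ := hq
  set r : ℝ → Euc n := fun ξ => if ξ ≤ τ then p.2 ξ else q.2 ξ with hr
  have hmt : -h ≤ t := by linarith
  have hi1 : IntervalIntegrable r volume t τ := by
    refine IntervalIntegrable.congr ?_ (hp2.mono_set (uIcc_subset_uIcc left_mem_uIcc
      (by rw [uIcc_of_le (htτ.trans hτT)]; exact ⟨htτ, hτT⟩)))
    intro ξ hξ
    rw [uIoc_of_le htτ] at hξ
    simp [hr, hξ.2]
  have hi2 : IntervalIntegrable r volume τ T := by
    refine IntervalIntegrable.congr ?_ hq2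
    intro ξ hξ
    rw [uIoc_of_le hτT] at hξ
    simp [hr, not_le.2 hξ.1]
  have e1 : ∀ b ∈ Icc t τ, ∫ ξ in t..b, r ξ = ∫ ξ in t..b, p.2 ξ := by
    intro b hb
    refine intervalIntegral.integral_congr fun ξ hξ => ?_
    rw [uIcc_of_le hb.1] at hξ
    simp [hr, hξ.2.trans hb.2]
  have e2 : ∀ b ∈ Icc τ T, ∫ ξ in τ..b, r ξ = ∫ ξ in τ..b, q.2 ξ := by
    intro b hb
    refine intervalIntegral.integral_congr_ae (Eventually.of_forall fun ξ hξ => ?_)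
    rw [uIoc_of_le hb.1] at hξ
    simp [hr, not_le.2 hξ.1]
  have eqp : ∀ ξ ∈ Icc (-h) τ, evalP q.1 ξ = evalP p.1 ξ := fun ξ hξ =>
    evalP_eq_of_stopped hτT hq1 hξ
  refine ⟨⟨?_, hi1.trans hi2, ?_⟩, ?_⟩
  · exact (stop_eq_mono hmt htτ hτT hq1).trans hp1
  · intro b hb
    show evalP q.1 b = evalP q.1 t + ∫ ξ in t..b, r ξ
    rw [eqp t ⟨hmt, htτ⟩]
    rcases le_total b τ with hbτ | hbτ
    · rw [eqp b ⟨hmt.trans hb.1, hbτ⟩, e1 b ⟨hb.1, hbτ⟩]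
      exact hp3 b hb
    · rw [← intervalIntegral.integral_add_adjacent_intervals hi1 (hi2.mono_set
        (uIcc_subset_uIcc left_mem_uIcc (by rw [uIcc_of_le hτT]; exact ⟨hbτ, hb.2⟩))),
        e1 τ ⟨htτ, le_rfl⟩, e2 b ⟨hbτ, hb.2⟩, hq3 b ⟨hbτ, hb.2⟩, eqp τ ⟨hmt.trans htτ, le_rfl⟩,
        hp3 τ ⟨htτ, hτT⟩, add_assoc]
  · rw [ae_restrict_iff' measurableSet_Icc] at hp4 hq4 ⊢
    filter_upwards [hp4, hq4] with ξ h1 h2 hξ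
    by_cases hle : ξ ≤ τ
    · have := h1 hξ
      simp only [hr, hle, if_true]
      rw [stop_eq_mono (hmt.trans hξ.1) hle hτT hq1]
      exact this
    · have := h2 ⟨(not_le.1 hle).le, hξ.2⟩
      simpa only [hr, hle, if_false] using this

lemma integ_sub {c : ℝ → ℝ} {T a b : ℝ} (hc : IntegNonneg T c) (ha : 0 ≤ a) (hab : a ≤ b)
    (hb : b ≤ T) : IntervalIntegrable c volume a b := by
  rw [intervalIntegrable_iff_integrableOn_Icc_of_le hab]
  exact hc.1.mono_set (Icc_subset_Icc ha hb)

lemma ypair_incr_stopped {n : ℕ} {h T t a b R : ℝ} {x : PathSp n h T} {c : ℝ → ℝ}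
    (ht : 0 ≤ t) (hc : IntegNonneg T c) {p : PathSp n h T × (ℝ → Euc n)}
    (hp : p ∈ YPair t x c) (hta : t ≤ a) (hab : a ≤ b) (hb : b ≤ T) (hR : ‖stopPath b p.1‖ ≤ R) :
    ‖evalP p.1 b - evalP p.1 a‖ ≤ ∫ ξ in a..b, c ξ * (1 + R) := by
  obtain ⟨⟨hp1, hp2, hp3⟩, hp4⟩ := hp
  have hia : IntervalIntegrable p.2 volume t a := hp2.mono_set (uIcc_subset_uIcc left_mem_uIcc
      (by rw [uIcc_of_le (hta.trans (hab.trans hb))]; exact ⟨hta, hab.trans hb⟩))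
  have hib : IntervalIntegrable p.2 volume t b := hp2.mono_set (uIcc_subset_uIcc left_mem_uIcc
      (by rw [uIcc_of_le (hta.trans (hab.trans hb))]; exact ⟨hta.trans hab, hb⟩))
  rw [hp3 b ⟨hta.trans hab, hb⟩, hp3 a ⟨hta, hab.trans hb⟩, add_sub_add_left_eq_sub,
    intervalIntegral.integral_interval_sub_left hib hia]
  refine intervalIntegral.norm_integral_le_of_norm_le hab ?_ 
    ((integ_sub hc (ht.trans hta) hab hb).mul_const _)
  rw [ae_restrict_iff' measurableSet_Icc] at hp4
  filter_upwards [hp4] with ξ h1 hξ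
  have hξ' : ξ ∈ Icc t T := ⟨hta.trans hξ.1.le, hξ.2.trans hb⟩
  refine (h1 hξ').trans ?_
  refine mul_le_mul_of_nonneg_left ?_ (hc.2 ξ ⟨ht.trans hξ'.1, hξ'.2⟩)
  have := norm_stop_mono p.1 hξ.2
  simp only at this
  linarith

/-- fine uniform partition for the primitive of an integrable function -/
lemma exists_partition {g : ℝ → ℝ} {T t d : ℝ} (ht : t ∈ Ico (0:ℝ) T) (hg : IntegNonneg T g)
    (hd : 0 < d) : ∃ N : ℕ, 0 < N ∧ ∃ P : ℕ → ℝ, P 0 = t ∧ P N = T ∧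
      ∀ i < N, t ≤ P i ∧ P i < P (i+1) ∧ P (i+1) ≤ T ∧ ∫ ξ in (P i)..(P (i+1)), g ξ ≤ d := by
  have hcont : ContinuousOn (fun τ => ∫ ξ in t..τ, g ξ) (Icc t T) := by
    have := intervalIntegral.continuousOn_primitive_interval (μ := volume) (f := g) (a := t) (b := T)
      (by rw [uIcc_of_le ht.2.le]; exact hg.1.mono_set (Icc_subset_Icc_left ht.1))
    rwa [uIcc_of_le ht.2.le] at this
  have huc := isCompact_Icc.uniformContinuousOn_of_continuous hcont
  rw [Metric.uniformContinuousOn_iff] at huc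
  obtain ⟨e, he, hue⟩ := huc d hd
  obtain ⟨N, hN⟩ := exists_nat_gt ((T - t) / e)
  have hTt : 0 < T - t := sub_pos.2 ht.2
  have hN0 : (0:ℝ) < N := lt_trans (div_pos hTt he) hN
  refine ⟨N, by exact_mod_cast hN0, fun i => t + i * ((T - t) / N), by simp, by field_simp; ring, ?_⟩
  intro i hi
  have hs : 0 < (T - t) / N := div_pos hTt hN0
  have hi1 : ((i:ℝ) + 1) ≤ N := by exact_mod_cast hi
  have hle : ((i:ℝ) + 1) * ((T - t) / N) ≤ T - t := by
    calc ((i:ℝ) + 1) * ((T - t) / N) ≤ N * ((T - t) / N) := by gcongr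
      _ = T - t := by field_simp
  have hi0 : 0 ≤ (i:ℝ) * ((T - t) / N) := by positivity
  have hse : (T - t) / N < e := by
    rw [div_lt_iff₀ hN0]; rw [div_lt_iff₀ he] at hN; linarith
  push_cast
  have A1 : t + i * ((T - t) / N) ∈ Icc t T := ⟨by linarith, by nlinarith⟩
  have A2 : t + ((i:ℝ) + 1) * ((T - t) / N) ∈ Icc t T := ⟨by nlinarith, by linarith⟩
  refine ⟨A1.1, by nlinarith, A2.2, ?_⟩
  have := hue _ A2 _ A1 (by rw [Real.dist_eq, abs_lt]; constructor <;> nlinarith)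
  rw [Real.dist_eq, intervalIntegral.integral_interval_sub_left
    (integ_sub hg ht.1 A2.1 A2.2) (integ_sub hg ht.1 A1.1 A1.2)] at this
  exact (le_abs_self _).trans this.le

lemma stop_incr {n : ℕ} {h T a b δ : ℝ} (w : PathSp n h T) (ha : -h ≤ a) (hab : a ≤ b) (hb : b ≤ T)
    (hw : ∀ ξ ∈ Icc a b, ‖evalP w ξ - evalP w a‖ ≤ δ) :
    ‖stopPath b w‖ ≤ max ‖stopPath a w‖ (‖evalP w a‖ + δ) := by
  rw [norm_stop_le_iff ⟨ha.trans hab, hb⟩ (le_max_of_le_left (norm_nonneg _))]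
  intro ξ hξ
  rcases le_total ξ a with h1 | h1
  · exact le_max_of_le_left (norm_eval_le_stopped ⟨ha, hab.trans hb⟩ ⟨hξ.1, h1⟩ w)
  · refine le_max_of_le_right ?_
    have := hw ξ ⟨h1, hξ.2⟩
    have h2 := norm_add_le (evalP w a) (evalP w ξ - evalP w a)
    rw [add_sub_cancel] at h2
    linarith

lemma ypair_incr_sub {n : ℕ} {h T t a b R : ℝ} {x : PathSp n h T} {c : ℝ → ℝ}
    (ht : 0 ≤ t) (hc : IntegNonneg T c) {p : PathSp n h T × (ℝ → Euc n)}
    (hp : p ∈ YPair t x c) (hta : t ≤ a) (hab : a ≤ b) (hb : b ≤ T) (hR : ‖stopPath b p.1‖ ≤ R)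
    {ξ : ℝ} (hξ : ξ ∈ Icc a b) :
    ‖evalP p.1 ξ - evalP p.1 a‖ ≤ ∫ ξ in a..b, c ξ * (1 + R) := by
  have h0 : 0 ≤ R := (norm_nonneg _).trans hR
  refine (ypair_incr_stopped ht hc hp hta hξ.1 (hξ.2.trans hb)
    ((norm_stop_mono p.1 hξ.2).trans hR)).trans ?_
  refine intervalIntegral.integral_mono_interval le_rfl hξ.1 hξ.2 ?_
    ((integ_sub hc (ht.trans hta) hab hb).mul_const _)
  rw [EventuallyLE, ae_restrict_iff' measurableSet_Ioc]
  refine Eventually.of_forall fun u hu => ?_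
  exact mul_nonneg (hc.2 u ⟨ht.trans (hta.trans hu.1.le), hu.2.trans hb⟩) (by linarith)

lemma yset_bounded {n : ℕ} {h T t : ℝ} (hh : 0 ≤ h) (ht : t ∈ Ico (0:ℝ) T) (x : PathSp n h T)
    {c : ℝ → ℝ} (hc : IntegNonneg T c) : ∃ R, 0 ≤ R ∧ ∀ y ∈ YSet t x c, ‖y‖ ≤ R := by
  obtain ⟨N, hN, P, hP0, hPN, hP⟩ := exists_partition (d := 1/2) ht hc (by norm_num)
  refine ⟨2 ^ N * (1 + ‖x‖), by positivity, ?_⟩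
  rintro y ⟨y', hy⟩
  have key : ∀ i ≤ N, 1 + ‖stopPath (P i) y‖ ≤ 2 ^ i * (1 + ‖x‖) := by
    intro i
    induction i with
    | zero =>
      intro _
      rw [hP0]
      have h1 : stopPath t y = stopPath t x := hy.1.1
      rw [h1]
      have := norm_stop_le t x
      simpa using this
    | succ i ih =>
      intro hi
      have IH := ih (by omega)
      obtain ⟨h1, h2, h3, h4⟩ := hP i (by omega)
      have hm : -h ≤ P i := by linarith [ht.1]
      have hs := stop_incr y hm h2.le h3 (fun ξ hξ =>
        ypair_incr_sub ht.1 hc hy h1 h2.le h3 le_rfl hξ)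
      rw [intervalIntegral.integral_mul_const] at hs
      have he := norm_eval_le_stopped ⟨hm, h2.le.trans h3⟩ ⟨hm, le_rfl⟩ y
      have hpos : 0 ≤ ∫ ξ in P i..P (i+1), c ξ :=
        intervalIntegral.integral_nonneg h2.le fun u hu =>
          hc.2 u ⟨ht.1.trans (h1.trans hu.1), hu.2.trans h3⟩
      have hn := norm_nonneg (stopPath (P (i+1)) y)
      have hs2 : ‖stopPath (P (i+1)) y‖ ≤ ‖stopPath (P i) y‖ + 1/2 * (1 + ‖stopPath (P (i+1)) y‖) := by
        refine hs.trans (max_le (by linarith) ?_)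
        have := mul_le_mul_of_nonneg_right h4 (by linarith : 0 ≤ 1 + ‖stopPath (P (i+1)) y‖)
        linarith
      rw [pow_succ]
      linarith
  have := key N le_rfl
  rw [hPN, stopPath_T] at this
  linarith

lemma yset_compact {n : ℕ} {h T t : ℝ} (hh : 0 ≤ h) (ht : t ∈ Ico (0:ℝ) T) (x : PathSp n h T)
    {c : ℝ → ℝ} (hc : IntegNonneg T c) : IsCompact (closure (YSet t x c)) := by
  obtain ⟨R, hR0, hR⟩ := yset_bounded hh ht x hc
  let I := ContinuousMap.isometryEquivBoundedOfCompact (Icc (-h) T) (Euc n)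
  have hmt : -h ≤ t := by linarith [ht.1]
  set A : ℝ → ℝ := fun τ => ∫ ξ in t..(max τ t), c ξ * (1 + R) with hA
  have hAc : Continuous (fun τ : Icc (-h) T => A τ.1) := by
    have h0 : ContinuousOn (fun τ => ∫ ξ in t..τ, c ξ * (1 + R)) (Icc t T) := by
      have := intervalIntegral.continuousOn_primitive_interval (μ := volume)
        (f := fun ξ => c ξ * (1 + R)) (a := t) (b := T)
        (by rw [uIcc_of_le ht.2.le]; exact (hc.1.mono_set (Icc_subset_Icc_left ht.1)).mul_const _)
      rwa [uIcc_of_le ht.2.le] at this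
    refine h0.comp_continuous (by fun_prop) fun τ => ⟨le_max_right _ _, max_le τ.2.2 ht.2.le⟩
  have hdiff : ∀ y ∈ YSet t x c, ∀ α β : Icc (-h) T, α.1 ≤ β.1 →
      ‖evalP y (max β.1 t) - evalP y (max α.1 t)‖ ≤ |A α - A β| := by
    rintro y ⟨y', hy⟩ α β hαβ
    have ha : max α.1 t ∈ Icc t T := ⟨le_max_right _ _, max_le α.2.2 ht.2.le⟩
    have hb : max β.1 t ∈ Icc t T := ⟨le_max_right _ _, max_le β.2.2 ht.2.le⟩
    have := ypair_incr_stopped ht.1 hc hy ha.1 (max_le_max_right t hαβ) hb.2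
      ((norm_stop_le _ _).trans (hR y ⟨y', hy⟩))
    refine this.trans ?_
    rw [abs_sub_comm, hA]
    simp only
    rw [intervalIntegral.integral_interval_sub_left
      ((integ_sub hc ht.1 hb.1 hb.2).mul_const _) ((integ_sub hc ht.1 ha.1 ha.2).mul_const _)]
    exact le_abs_self _
  have hrep : ∀ y ∈ YSet t x c, ∀ α : Icc (-h) T,
      y α = stopPath t x α + (evalP y (max α.1 t) - evalP y t) := by
    rintro y ⟨y', hy⟩ α
    have h1 : stopPath t y = stopPath t x := hy.1.1
    rw [← h1, stopPath_apply, ← evalP_coe]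
    rcases le_total α.1 t with h2 | h2
    · rw [min_eq_left h2, max_eq_right h2, max_eq_right α.2.1]; simp
    · rw [min_eq_right h2, max_eq_left h2, max_eq_right hmt]; simp
  have hdist : ∀ y ∈ YSet t x c, ∀ α β : Icc (-h) T,
      dist (y α) (y β) ≤ dist (stopPath t x α) (stopPath t x β) + |A α - A β| := by
    intro y hy α β
    rw [hrep y hy α, hrep y hy β, dist_eq_norm, dist_eq_norm]
    have : stopPath t x α + (evalP y (max α.1 t) - evalP y t) -
        (stopPath t x β + (evalP y (max β.1 t) - evalP y t)) =
        (stopPath t x α - stopPath t x β) + (evalP y (max α.1 t) - evalP y (max β.1 t)) := by abel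
    rw [this]
    refine (norm_add_le _ _).trans (add_le_add_right ?_ _)
    rcases le_total α.1 β.1 with h1 | h1
    · rw [norm_sub_rev]; exact hdiff y hy α β h1
    · rw [abs_sub_comm]; exact hdiff y hy β α h1
  have hcomp : IsCompact (closure (I '' YSet t x c)) := by
    refine BoundedContinuousFunction.arzela_ascoli (Metric.closedBall 0 R)
      (isCompact_closedBall _ _) _ ?_ ?_
    · rintro _ α ⟨y, hy, rfl⟩
      rw [mem_closedBall_zero_iff]
      exact (ContinuousMap.norm_coe_le_norm y α).trans (hR y hy)
    · intro α
      refine Metric.equicontinuousAt_of_continuity_modulus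
        (fun β => dist (stopPath t x α) (stopPath t x β) + |A α - A β|) ?_ _ ?_
      · have : Continuous (fun β : Icc (-h) T =>
            dist (stopPath t x α) (stopPath t x β) + |A α - A β|) :=
          (continuous_const.dist (stopPath t x).continuous).add (continuous_const.sub hAc).abs
        have h2 := this.tendsto α
        simpa using h2
      · refine Eventually.of_forall fun β => ?_
        rintro ⟨_, y, hy, rfl⟩
        exact hdist y hy α β
  have : closure (YSet t x c) = I ⁻¹' (closure (I '' YSet t x c)) := by
    have h1 := I.toHomeomorph.isOpenMap.preimage_closure_eq_closure_preimage I.continuous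
      (I '' YSet t x c)
    have h2 : I ⁻¹' (I '' YSet t x c) = YSet t x c := Set.preimage_image_eq _ I.injective
    calc closure (YSet t x c) = closure (I ⁻¹' (I '' YSet t x c)) := by rw [h2]
      _ = _ := h1.symm
  rw [this]
  exact I.toHomeomorph.isCompact_preimage.2 hcomp

/-- The algebraic one-step estimate for `V = (m - r)^2 + r^2`. -/
lemma V_step {E : Type*} [NormedAddCommGroup E] [InnerProductSpace ℝ E] (w w' : E)
    {μ μ' R δ : ℝ} (hw : ‖w‖ ≤ μ) (hw' : ‖w'‖ ≤ μ') (hμ : μ ≤ μ') (hμR : μ' ≤ R)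
    (hd : ‖w' - w‖ ≤ δ) (hmax : μ' ≤ max μ (‖w‖ + δ)) :
    ((μ' ^ 2 - ‖w'‖ ^ 2) ^ 2 + (‖w'‖ ^ 2) ^ 2) - ((μ ^ 2 - ‖w‖ ^ 2) ^ 2 + (‖w‖ ^ 2) ^ 2) ≤
      inner ℝ ((4 * (2 * ‖w‖ ^ 2 - μ ^ 2)) • w) (w' - w) + 50 * R ^ 2 * δ ^ 2 := by
  have hexp : ‖w'‖ ^ 2 = ‖w‖ ^ 2 + 2 * inner ℝ w (w' - w) + ‖w' - w‖ ^ 2 := by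
    have := norm_add_sq_real w (w' - w)
    rwa [add_sub_cancel] at this
  rw [real_inner_smul_left]
  have hn := norm_nonneg w
  have hn' := norm_nonneg w'
  have hq := norm_nonneg (w' - w)
  have hr1 : ‖w'‖ ≤ ‖w‖ + δ := by
    have := norm_add_le w (w' - w); rw [add_sub_cancel] at this; linarith
  have hr2 : ‖w‖ ≤ ‖w'‖ + δ := by
    have := norm_sub_norm_le w w'; rw [norm_sub_rev] at this; linarith
  set r := ‖w‖
  set r' := ‖w'‖
  set q := ‖w' - w‖
  set ip : ℝ := inner ℝ w (w' - w)
  have hδ : 0 ≤ δ := hq.trans hd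
  have hR : 0 ≤ R := by linarith
  have hq2 : q ^ 2 ≤ δ ^ 2 := by gcongr
  -- d
  obtain ⟨d, hdd⟩ : ∃ d, d = r' ^ 2 - r ^ 2 := ⟨_, rfl⟩
  have hipd : 2 * ip = d - q ^ 2 := by linarith
  have hd1 : d ≤ 2 * R * δ := by
    have : d = (r' - r) * (r' + r) := by rw [hdd]; ring
    rw [this]; nlinarith
  have hd2 : -(2 * R * δ) ≤ d := by
    have : d = (r' - r) * (r' + r) := by rw [hdd]; ring
    rw [this]; nlinarith
  have hdsq : d ^ 2 ≤ (2 * R * δ) ^ 2 := sq_le_sq' hd2 hd1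
  have hr'e : r' ^ 2 = r ^ 2 + d := by linarith
  have hcoef1 : 2 * r ^ 2 - μ ^ 2 ≤ R ^ 2 := by nlinarith
  have hcoef2 : (2 * r ^ 2 - μ ^ 2) * q ^ 2 ≤ R ^ 2 * δ ^ 2 := by
    calc (2 * r ^ 2 - μ ^ 2) * q ^ 2 ≤ R ^ 2 * q ^ 2 := by gcongr
      _ ≤ R ^ 2 * δ ^ 2 := by gcongr
  have hgoal : 4 * (2 * r ^ 2 - μ ^ 2) * ip = 2 * (2 * r ^ 2 - μ ^ 2) * d
      - 2 * ((2 * r ^ 2 - μ ^ 2) * q ^ 2) := by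
    calc 4 * (2 * r ^ 2 - μ ^ 2) * ip = 2 * (2 * r ^ 2 - μ ^ 2) * (2 * ip) := by ring
      _ = _ := by rw [hipd]; ring
  rw [hgoal]
  rcases le_total (r + δ) μ with hc | hc
  · have : μ' = μ := le_antisymm (by rwa [max_eq_left hc] at hmax) hμ
    rw [this, hr'e]
    nlinarith [sq_nonneg (R * δ)]
  · rw [max_eq_right hc] at hmax
    obtain ⟨u, hu⟩ : ∃ u, u = μ ^ 2 - r ^ 2 := ⟨_, rfl⟩
    obtain ⟨v, hv⟩ : ∃ v, v = μ' ^ 2 - r' ^ 2 := ⟨_, rfl⟩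
    have hu0 : 0 ≤ u := by rw [hu]; nlinarith
    have hv0 : 0 ≤ v := by rw [hv]; nlinarith
    have hu1 : u ≤ 2 * R * δ := by
      have : u = (μ - r) * (μ + r) := by rw [hu]; ring
      rw [this]; nlinarith
    have hv1 : v ≤ 4 * R * δ := by
      have : v = (μ' - r') * (μ' + r') := by rw [hv]; ring
      rw [this]; nlinarith
    have hv2 : v ^ 2 ≤ (4 * R * δ) ^ 2 := by gcongr
    have hud : u * d ≤ (2 * R * δ) * (2 * R * δ) := by
      calc u * d ≤ u * (2 * R * δ) := by gcongr
        _ ≤ _ := by gcongr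
    have e1 : 2 * (2 * r ^ 2 - μ ^ 2) * d = 2 * r ^ 2 * d - 2 * (u * d) := by rw [hu]; ring
    rw [← hv, ← hu, hr'e, e1]
    linarith [sq_nonneg (R * δ), sq_nonneg u]

/-- Scalar one-step estimate. -/
lemma scalar_step {G G' V V' μ R δ δs ε η θ θ' θT s ip : ℝ}
    (hε : 0 < ε) (hη : 0 < η) (hεη : ε = η ^ 3 * θT) (hθT : 0 < θT) (hθ1 : θT ≤ θ') (hθ2 : θ' ≤ 1)
    (hθ : θ' * (1 + 10 * δ) ≤ θ) (hδ : 0 ≤ δ) (hδs : δ ≤ δs) (hμ : 0 ≤ μ) (hμR : μ ≤ R)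
    (hV : μ ^ 4 ≤ 2 * V) (hs0 : 0 ≤ s) (hs : s ≤ θ' / ε * (4 * μ ^ 3))
    (hip : V' - V ≤ ip + 50 * R ^ 2 * δ ^ 2)
    (hG : G + θ' / ε * ip - δ * ((1 + s) * (μ + δ)) ≤ G') :
    G - θ / ε * V - η * δ - (50 * R ^ 2 / ε + 1 + 4 * R ^ 3 / ε) * δs * δ ≤ G' - θ' / ε * V' := by
  have hR : 0 ≤ R := hμ.trans hμR
  have hθ'0 : 0 < θ' := hθT.trans_le hθ1
  have hV0 : 0 ≤ V := by have : 0 ≤ μ ^ 4 := by positivity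
                         linarith
  obtain ⟨k, hk⟩ : ∃ k, k = θ' / ε := ⟨_, rfl⟩
  have hk0 : 0 < k := hk ▸ div_pos hθ'0 hε
  have hk1 : k ≤ 1 / ε := by rw [hk]; gcongr
  have hk2 : 1 / η ^ 3 ≤ k := by
    rw [hk, hεη, div_le_div_iff₀ (by positivity) (by positivity)]
    have : 0 < η ^ 3 := by positivity
    nlinarith
  have hkθ : k * (1 + 10 * δ) ≤ θ / ε := by
    rw [hk, div_mul_eq_mul_div]; gcongr
  have hμη : μ ≤ η + k * μ ^ 4 := by
    rcases le_total μ η with h1 | h1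
    · have : 0 ≤ k * μ ^ 4 := by positivity
      linarith
    · have : μ ≤ 1 / η ^ 3 * μ ^ 4 := by
        rw [div_mul_eq_mul_div, le_div_iff₀ (by positivity), one_mul]
        have : η ^ 3 ≤ μ ^ 3 := by gcongr
        calc μ * η ^ 3 ≤ μ * μ ^ 3 := by gcongr
          _ = μ ^ 4 := by ring
      have h2 : 1 / η ^ 3 * μ ^ 4 ≤ k * μ ^ 4 := by gcongr
      linarith
  rw [← hk] at hG hs ⊢
  have hδ2 : δ ^ 2 ≤ δs * δ := by rw [sq]; gcongr
  have t1 : k * (50 * R ^ 2 * δ ^ 2) ≤ 50 * R ^ 2 / ε * δs * δ := by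
    calc k * (50 * R ^ 2 * δ ^ 2) ≤ 1 / ε * (50 * R ^ 2 * (δs * δ)) := by gcongr
      _ = _ := by ring
  have t2 : s * μ ≤ 4 * (k * μ ^ 4) := by
    calc s * μ ≤ k * (4 * μ ^ 3) * μ := by gcongr
      _ = _ := by ring
  have t3 : s ≤ 4 * R ^ 3 / ε := by
    calc s ≤ k * (4 * μ ^ 3) := hs
      _ ≤ 1 / ε * (4 * R ^ 3) := by gcongr
      _ = _ := by ring
  have t4 : δ * ((1 + s) * (μ + δ)) ≤ η * δ + 5 * (k * μ ^ 4) * δ + (1 + 4 * R ^ 3 / ε) * δs * δ := by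
    have e : δ * ((1 + s) * (μ + δ)) = δ * μ + δ * (s * μ) + (1 + s) * δ ^ 2 := by ring
    have a1 : δ * μ ≤ δ * (η + k * μ ^ 4) := by gcongr
    have a2 : δ * (s * μ) ≤ δ * (4 * (k * μ ^ 4)) := by gcongr
    have a3 : (1 + s) * δ ^ 2 ≤ (1 + 4 * R ^ 3 / ε) * (δs * δ) := by gcongr
    rw [e]; linarith
  have t5 : 5 * (k * μ ^ 4) * δ ≤ k * (10 * δ) * V := by
    calc 5 * (k * μ ^ 4) * δ ≤ 5 * (k * (2 * V)) * δ := by gcongr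
      _ = _ := by ring
  have t6 : k * (1 + 10 * δ) * V ≤ θ / ε * V := by gcongr
  have t7 : k * (V' - V) ≤ k * (ip + 50 * R ^ 2 * δ ^ 2) := by gcongr
  linarith

/-- The Lyapunov-type functional. -/
def lyapV {n : ℕ} {h T : ℝ} (w : PathSp n h T) (τ : ℝ) : ℝ :=
  (‖stopPath τ w‖ ^ 2 - ‖evalP w τ‖ ^ 2) ^ 2 + (‖evalP w τ‖ ^ 2) ^ 2

lemma int_inner_H {n : ℕ} {h T t a b : ℝ} {x : PathSp n h T}
    (hta : t ≤ a) (hab : a ≤ b) (hbT : b ≤ T)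
    {c : ℝ → ℝ} {p : PathSp n h T × (ℝ → Euc n)} (hp : p ∈ YPair a x c) (s : Euc n)
    {f : ℝ → ℝ} (hf : IntervalIntegrable f volume a b) :
    ∫ ξ in a..b, (@inner ℝ _ _ s (p.2 ξ) - f ξ) =
      @inner ℝ _ _ s (evalP p.1 b - evalP p.1 a) - ∫ ξ in a..b, f ξ := by
  obtain ⟨⟨hp1, hp2, hp3⟩, hp4⟩ := hp
  have hi : IntervalIntegrable p.2 volume a b := hp2.mono_set (uIcc_subset_uIcc left_mem_uIcc
      (by rw [uIcc_of_le (hab.trans hbT)]; exact ⟨hab, hbT⟩))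
  have h1 := (innerSL ℝ s).intervalIntegral_comp_comm hi
  have hi2 : IntervalIntegrable (fun ξ => @inner ℝ _ _ s (p.2 ξ)) volume a b := by
    constructor
    · exact (innerSL ℝ s).integrable_comp hi.1
    · exact (innerSL ℝ s).integrable_comp hi.2
  rw [intervalIntegral.integral_sub hi2 hf, hp3 b ⟨hab, hbT⟩, add_sub_cancel_left]
  congr 1

lemma one_step {n : ℕ} {h T : ℝ} (hh : 0 ≤ h)
    {Hu Hl : ℝ → PathSp n h T → Euc n → ℝ} {cu cl lam g : ℝ → ℝ}
    (hcu : IntegNonneg T cu) (hcl : IntegNonneg T cl) (hlam : IntegNonneg T lam)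
    (hg : IntegNonneg T g) {R : ℝ} (hR : 0 ≤ R)
    (hgdef : ∀ ξ, g ξ = lam ξ + (cu ξ * (1 + R) + cl ξ * (1 + R)))
    {t : ℝ} (ht : t ∈ Ico (0:ℝ) T) {x : PathSp n h T}
    (hRu : ∀ y ∈ YSet t x cu, ‖y‖ ≤ R) (hRl : ∀ y ∈ YSet t x cl, ‖y‖ ≤ R)
    (hintu : ∀ y s, IntegrableOn (fun ξ => Hu ξ y s) (Icc 0 T))
    (hintl : ∀ y s, IntegrableOn (fun ξ => Hl ξ y s) (Icc 0 T))
    (hlip : ∀ y₁ ∈ YSet t x cu, ∀ y₂ ∈ YSet t x cl, ∀ s,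
      ∀ᵐ ξ ∂(volume.restrict (Icc t T)), |Hu ξ y₁ s - Hl ξ y₂ s| ≤
        lam ξ * (1 + ‖s‖) * ‖stopPath ξ y₁ - stopPath ξ y₂‖)
    {φu φl : ℝ → PathSp n h T → ℝ} (hU : PropU Hu cu φu) (hL : PropL Hl cl φl)
    {ε η δs a b : ℝ} (hη : 0 < η)
    (hεη : ε = η ^ 3 * Real.exp (-(10 * ∫ ξ in t..T, g ξ)))
    (hta : t ≤ a) (hab : a < b) (hbT : b ≤ T) (hδs : ∫ ξ in a..b, g ξ ≤ δs)
    {p₁ p₂ : PathSp n h T × (ℝ → Euc n)} (hp₁ : p₁ ∈ YPair t x cu) (hp₂ : p₂ ∈ YPair t x cl) :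
    ∃ q₁ ∈ YPair t x cu, ∃ q₂ ∈ YPair t x cl,
      (φl a p₂.1 - φu a p₁.1)
        - Real.exp (-(10 * ∫ ξ in t..a, g ξ)) / ε * lyapV (p₁.1 - p₂.1) a
        - η * (∫ ξ in a..b, g ξ)
        - (50 * (2 * R) ^ 2 / ε + 1 + 4 * (2 * R) ^ 3 / ε) * δs * (∫ ξ in a..b, g ξ) ≤
      (φl b q₂.1 - φu b q₁.1)
        - Real.exp (-(10 * ∫ ξ in t..b, g ξ)) / ε * lyapV (q₁.1 - q₂.1) b := by
  have ha0 : 0 ≤ a := ht.1.trans hta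
  have hma : -h ≤ a := by linarith
  have haT : a ≤ T := hab.le.trans hbT
  set w := p₁.1 - p₂.1 with hw
  set μ := ‖stopPath a w‖ with hμ
  set δ := ∫ ξ in a..b, g ξ with hδ
  set θ' := Real.exp (-(10 * ∫ ξ in t..b, g ξ)) with hθ'
  have hθ'0 : 0 < θ' := Real.exp_pos _
  have hε : 0 < ε := by rw [hεη]; positivity
  set P : Euc n := (4 * (2 * ‖evalP w a‖ ^ 2 - μ ^ 2)) • evalP w a with hP
  set s : Euc n := (-(θ' / ε)) • P with hs
  obtain ⟨q₁, hq₁, hq₁i⟩ := hU a ⟨ha0, hab.trans_le hbT⟩ p₁.1 s b ⟨hab, hbT⟩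
  obtain ⟨q₂, hq₂, hq₂i⟩ := hL a ⟨ha0, hab.trans_le hbT⟩ p₂.1 s b ⟨hab, hbT⟩
  have hQ₁ := ypair_concat hh ht.1 hta haT hp₁ hq₁
  have hQ₂ := ypair_concat hh ht.1 hta haT hp₂ hq₂
  have hY₁ : q₁.1 ∈ YSet t x cu := ⟨_, hQ₁⟩
  have hY₂ : q₂.1 ∈ YSet t x cl := ⟨_, hQ₂⟩
  refine ⟨_, hQ₁, _, hQ₂, ?_⟩
  simp only
  set z := q₁.1 - q₂.1 with hz
  have hzw : stopPath a z = stopPath a w := by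
    rw [hz, hw, stopPath_sub, stopPath_sub, hq₁.1.1, hq₂.1.1]
  have hzwa : evalP z a = evalP w a := evalP_eq_of_stopped haT hzw ⟨hma, le_rfl⟩
  have hgi : IntervalIntegrable g volume a b := integ_sub hg ha0 hab.le hbT
  have hcui : IntervalIntegrable cu volume a b := integ_sub hcu ha0 hab.le hbT
  have hcli : IntervalIntegrable cl volume a b := integ_sub hcl ha0 hab.le hbT
  have hlami : IntervalIntegrable lam volume a b := integ_sub hlam ha0 hab.le hbT
  have hlam0 : 0 ≤ ∫ ξ in a..b, lam ξ := intervalIntegral.integral_nonneg hab.le fun u hu =>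
    hlam.2 u ⟨ha0.trans hu.1, hu.2.trans hbT⟩
  have hδ0 : 0 ≤ δ := intervalIntegral.integral_nonneg hab.le fun u hu =>
    hg.2 u ⟨ha0.trans hu.1, hu.2.trans hbT⟩
  have hδe : δ = (∫ ξ in a..b, lam ξ) + ((∫ ξ in a..b, cu ξ * (1 + R)) +
      ∫ ξ in a..b, cl ξ * (1 + R)) := by
    rw [hδ, ← intervalIntegral.integral_add (hcui.mul_const _) (hcli.mul_const _),
      ← intervalIntegral.integral_add hlami ((hcui.mul_const _).add (hcli.mul_const _))]
    simp only [hgdef]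
  have hzinc : ∀ ξ ∈ Icc a b, ‖evalP z ξ - evalP z a‖ ≤ δ := by
    intro ξ hξ
    have h1 := ypair_incr_sub ha0 hcu hq₁ le_rfl hab.le hbT
      ((norm_stop_le _ _).trans (hRu _ hY₁)) hξ
    have h2 := ypair_incr_sub ha0 hcl hq₂ le_rfl hab.le hbT
      ((norm_stop_le _ _).trans (hRl _ hY₂)) hξ
    rw [hz, evalP_sub, evalP_sub, sub_sub_sub_comm]
    refine (norm_sub_le _ _).trans ?_
    linarith
  have hmax := stop_incr z hma hab.le hbT hzinc
  rw [hzw, hzwa] at hmax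
  have hwa : ‖evalP w a‖ ≤ μ := norm_eval_le_stopped ⟨hma, haT⟩ ⟨hma, le_rfl⟩ w
  have hzb : ‖evalP z b‖ ≤ ‖stopPath b z‖ :=
    norm_eval_le_stopped ⟨hma.trans hab.le, hbT⟩ ⟨hma.trans hab.le, le_rfl⟩ z
  have hmono : μ ≤ ‖stopPath b z‖ := by
    rw [hμ, ← hzw]; exact norm_stop_mono z hab.le
  have hzR : ‖stopPath b z‖ ≤ 2 * R := by
    refine (norm_stop_le _ _).trans ((norm_sub_le _ _).trans ?_)
    have := hRu _ hY₁
    have := hRl _ hY₂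
    linarith
  have hstopξ : ∀ ξ ≤ b, ‖stopPath ξ z‖ ≤ μ + δ := by
    intro ξ hξ
    refine (norm_stop_mono z hξ).trans (hmax.trans (max_le (by linarith) (by linarith)))
  have hstep := V_step (evalP w a) (evalP z b) hwa hzb hmono hzR
    (by have := hzinc b ⟨hab.le, le_rfl⟩; rwa [hzwa] at this) hmax
  have hμ0 : 0 ≤ μ := norm_nonneg _
  have hHu : IntervalIntegrable (fun ξ => Hu ξ q₁.1 s) volume a b := by
    rw [intervalIntegrable_iff_integrableOn_Icc_of_le hab.le]
    exact (hintu _ _).mono_set (Icc_subset_Icc ha0 hbT)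
  have hHl : IntervalIntegrable (fun ξ => Hl ξ q₂.1 s) volume a b := by
    rw [intervalIntegrable_iff_integrableOn_Icc_of_le hab.le]
    exact (hintl _ _).mono_set (Icc_subset_Icc ha0 hbT)
  rw [int_inner_H hta hab.le hbT hq₁ s hHu] at hq₁i
  rw [int_inner_H hta hab.le hbT hq₂ s hHl] at hq₂i
  have hdiff : |(∫ ξ in a..b, Hu ξ q₁.1 s) - ∫ ξ in a..b, Hl ξ q₂.1 s| ≤
      δ * ((1 + ‖s‖) * (μ + δ)) := by
    rw [← intervalIntegral.integral_sub hHu hHl, hδ, ← intervalIntegral.integral_mul_const,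
      ← Real.norm_eq_abs]
    refine intervalIntegral.norm_integral_le_of_norm_le hab.le ?_ (hgi.mul_const _)
    have := hlip _ hY₁ _ hY₂ s
    rw [ae_restrict_iff' measurableSet_Icc] at this
    filter_upwards [this] with ξ h1 hξ
    have hξ' : ξ ∈ Icc t T := ⟨hta.trans hξ.1.le, hξ.2.trans hbT⟩
    have hξ0 : ξ ∈ Icc 0 T := ⟨ht.1.trans hξ'.1, hξ'.2⟩
    refine (h1 hξ').trans ?_
    rw [← stopPath_sub, mul_assoc]
    have e1 : lam ξ ≤ g ξ := by
      have := mul_nonneg (hcu.2 ξ hξ0) (by linarith : 0 ≤ 1 + R)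
      have := mul_nonneg (hcl.2 ξ hξ0) (by linarith : 0 ≤ 1 + R)
      rw [hgdef]; linarith
    have e2 := hstopξ ξ hξ.2
    have e3 := hg.2 ξ hξ0
    have e4 := norm_nonneg s
    gcongr
  have hadj : (∫ ξ in t..a, g ξ) + δ = ∫ ξ in t..b, g ξ :=
    intervalIntegral.integral_add_adjacent_intervals (integ_sub hg ht.1 hta haT) hgi
  have hadj2 : (∫ ξ in t..b, g ξ) + (∫ ξ in b..T, g ξ) = ∫ ξ in t..T, g ξ :=
    intervalIntegral.integral_add_adjacent_intervals (integ_sub hg ht.1 (hta.trans hab.le) hbT)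
      (integ_sub hg (ha0.trans hab.le) hbT le_rfl)
  have hnn1 : 0 ≤ ∫ ξ in t..b, g ξ := intervalIntegral.integral_nonneg (hta.trans hab.le) fun u hu =>
    hg.2 u ⟨ht.1.trans hu.1, hu.2.trans hbT⟩
  have hnn2 : 0 ≤ ∫ ξ in b..T, g ξ := intervalIntegral.integral_nonneg hbT fun u hu =>
    hg.2 u ⟨ha0.trans (hab.le.trans hu.1), hu.2⟩
  have hsn : ‖s‖ ≤ θ' / ε * (4 * μ ^ 3) := by
    rw [hs, norm_smul, norm_neg, Real.norm_of_nonneg (by positivity), hP, norm_smul,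
      Real.norm_eq_abs]
    have h1 : |4 * (2 * ‖evalP w a‖ ^ 2 - μ ^ 2)| ≤ 4 * μ ^ 2 := by
      have : ‖evalP w a‖ ^ 2 ≤ μ ^ 2 := by gcongr
      have h0 : 0 ≤ ‖evalP w a‖ ^ 2 := by positivity
      rw [abs_le]; constructor <;> linarith
    have : |4 * (2 * ‖evalP w a‖ ^ 2 - μ ^ 2)| * ‖evalP w a‖ ≤ 4 * μ ^ 3 := by
      calc _ ≤ 4 * μ ^ 2 * μ := by gcongr
        _ = _ := by ring
    gcongr
  refine scalar_step (ip := inner ℝ P (evalP z b - evalP w a)) (s := ‖s‖) (μ := μ)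
    hε hη hεη (Real.exp_pos _) ?_ ?_ ?_ hδ0 hδs hμ0 (hmono.trans hzR) ?_ (norm_nonneg _) hsn hstep ?_
  · rw [hθ']; gcongr; linarith
  · rw [hθ']; exact Real.exp_le_one_iff.2 (by linarith)
  · have h1 : Real.exp (-(10 * ∫ ξ in t..a, g ξ)) = θ' * Real.exp (10 * δ) := by
      rw [hθ', ← Real.exp_add, ← hadj]; congr 1; ring
    rw [h1]
    have := Real.add_one_le_exp (10 * δ)
    gcongr
    linarith
  · unfold lyapV
    rw [← hμ]
    nlinarith [sq_nonneg (μ ^ 2 - 2 * ‖evalP w a‖ ^ 2)]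
  · have e1 : inner ℝ s (evalP q₁.1 b - evalP q₁.1 a) - inner ℝ s (evalP q₂.1 b - evalP q₂.1 a) =
        -(θ' / ε * inner ℝ P (evalP z b - evalP w a)) := by
      rw [← inner_sub_right, ← hzwa, hz, evalP_sub, evalP_sub, hs, real_inner_smul_left,
        sub_sub_sub_comm]
      ring
    have e2 := (abs_le.1 hdiff).1
    linarith

lemma comparison {n : ℕ} {h T : ℝ} (hh : 0 ≤ h)
    {Hu Hl : ℝ → PathSp n h T → Euc n → ℝ} {cu cl lam : ℝ → ℝ}
    (hcu : IntegNonneg T cu) (hcl : IntegNonneg T cl) (hlam : IntegNonneg T lam)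
    {t : ℝ} (ht : t ∈ Ico (0:ℝ) T) {x : PathSp n h T}
    (hintu : ∀ y s, IntegrableOn (fun ξ => Hu ξ y s) (Icc 0 T))
    (hintl : ∀ y s, IntegrableOn (fun ξ => Hl ξ y s) (Icc 0 T))
    (hlip : ∀ y₁ ∈ YSet t x cu, ∀ y₂ ∈ YSet t x cl, ∀ s,
      ∀ᵐ ξ ∂(volume.restrict (Icc t T)), |Hu ξ y₁ s - Hl ξ y₂ s| ≤
        lam ξ * (1 + ‖s‖) * ‖stopPath ξ y₁ - stopPath ξ y₂‖)
    {φu φl : ℝ → PathSp n h T → ℝ} (hU : PropU Hu cu φu) (hL : PropL Hl cl φl)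
    {σ : PathSp n h T → ℝ} (hσ : Continuous σ)
    (hNu : NonAnticipative φu) (hNl : NonAnticipative φl)
    (hφu : ∀ y, σ y ≤ φu T y) (hφl : ∀ y, φl T y ≤ σ y) : φl t x ≤ φu t x := by
  by_contra hcon
  push Not at hcon
  set G₀ := φl t x - φu t x with hG₀
  have hG₀pos : 0 < G₀ := sub_pos.2 hcon
  obtain ⟨Ru, hRu0, hRu⟩ := yset_bounded hh ht x hcu
  obtain ⟨Rl, hRl0, hRl⟩ := yset_bounded hh ht x hcl
  obtain ⟨R, hR⟩ : ∃ R, R = max Ru Rl := ⟨_, rfl⟩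
  have hR0 : 0 ≤ R := hR ▸ le_max_of_le_left hRu0
  set D := closure (YSet t x cu) ∪ closure (YSet t x cl) with hD
  have hDc : IsCompact D := (yset_compact hh ht x hcu).union (yset_compact hh ht x hcl)
  obtain ⟨M, hM⟩ := (hDc.image hσ).isBounded.exists_norm_le
  have hDu : ∀ y ∈ YSet t x cu, y ∈ D := fun y hy => Or.inl (subset_closure hy)
  have hDl : ∀ y ∈ YSet t x cl, y ∈ D := fun y hy => Or.inr (subset_closure hy)
  have huc := hDc.uniformContinuousOn_of_continuous hσ.continuousOn
  rw [Metric.uniformContinuousOn_iff] at huc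
  obtain ⟨ρ, hρ, hσρ⟩ := huc (G₀ / 2) (by positivity)
  set g : ℝ → ℝ := fun ξ => lam ξ + (cu ξ * (1 + R) + cl ξ * (1 + R)) with hgd
  have hg : IntegNonneg T g := by
    refine ⟨hlam.1.add ((hcu.1.mul_const _).add (hcl.1.mul_const _)), fun τ hτ => ?_⟩
    have := hlam.2 τ hτ
    have := hcu.2 τ hτ
    have := hcl.2 τ hτ
    rw [hgd]; positivity
  set Λ := ∫ ξ in t..T, g ξ with hΛ
  have hΛ0 : 0 ≤ Λ := intervalIntegral.integral_nonneg ht.2.le fun u hu =>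
    hg.2 u ⟨ht.1.trans hu.1, hu.2⟩
  -- trivial path
  obtain ⟨p₁0, hp₁0, -⟩ := hU t ht x 0 T ⟨ht.2, le_rfl⟩
  obtain ⟨p₂0, hp₂0, -⟩ := hL t ht x 0 T ⟨ht.2, le_rfl⟩
  have hM0 : 0 ≤ M := (norm_nonneg _).trans (hM _ ⟨_, hDu _ ⟨_, hp₁0⟩, rfl⟩)
  -- choose η
  obtain ⟨η, hη, hη1, hη2⟩ : ∃ η : ℝ, 0 < η ∧ η * (Λ + 1) < G₀ / 2 ∧
      2 * η ^ 3 * (2 * M + G₀) < ρ ^ 4 := by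
    have c1 : ∀ᶠ η in 𝓝[>] (0:ℝ), η * (Λ + 1) < G₀ / 2 := by
      have : Tendsto (fun η : ℝ => η * (Λ + 1)) (𝓝[>] 0) (𝓝 (0 * (Λ + 1))) :=
        (Continuous.tendsto (by fun_prop) 0).mono_left nhdsWithin_le_nhds
      exact this.eventually_lt_const (by rw [zero_mul]; positivity)
    have c2 : ∀ᶠ η in 𝓝[>] (0:ℝ), 2 * η ^ 3 * (2 * M + G₀) < ρ ^ 4 := by
      have : Tendsto (fun η : ℝ => 2 * η ^ 3 * (2 * M + G₀)) (𝓝[>] 0)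
          (𝓝 (2 * (0:ℝ) ^ 3 * (2 * M + G₀))) :=
        (Continuous.tendsto (by fun_prop) 0).mono_left nhdsWithin_le_nhds
      exact this.eventually_lt_const (by norm_num; positivity)
    obtain ⟨η, h1, h2, h3⟩ := (c1.and (c2.and self_mem_nhdsWithin)).exists
    exact ⟨η, h3, h1, h2⟩
  obtain ⟨ε, hεη⟩ : ∃ ε, ε = η ^ 3 * Real.exp (-(10 * Λ)) := ⟨_, rfl⟩
  have hε : 0 < ε := by rw [hεη]; positivity
  obtain ⟨K, hK⟩ : ∃ K, K = 50 * (2 * R) ^ 2 / ε + 1 + 4 * (2 * R) ^ 3 / ε := ⟨_, rfl⟩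
  have hK0 : 0 < K := by rw [hK]; positivity
  obtain ⟨δs, hδs⟩ : ∃ δs, δs = η / (K * (Λ + 1)) := ⟨_, rfl⟩
  have hδs0 : 0 < δs := by rw [hδs]; positivity
  have hKδ : K * δs * Λ ≤ η := by
    rw [hδs]
    have : K * (η / (K * (Λ + 1))) * Λ = η * (Λ / (Λ + 1)) := by field_simp
    rw [this]
    have : Λ / (Λ + 1) ≤ 1 := by rw [div_le_one (by positivity)]; linarith
    nlinarith
  obtain ⟨N, hN, P, hP0, hPN, hP⟩ := exists_partition ht hg hδs0
  have key : ∀ i ≤ N, ∃ p₁ ∈ YPair t x cu, ∃ p₂ ∈ YPair t x cl,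
      G₀ - η * (∫ ξ in t..(P i), g ξ) - K * δs * (∫ ξ in t..(P i), g ξ) ≤
        (φl (P i) p₂.1 - φu (P i) p₁.1)
        - Real.exp (-(10 * ∫ ξ in t..(P i), g ξ)) / ε * lyapV (p₁.1 - p₂.1) (P i) := by
    intro i
    induction i with
    | zero =>
      intro _
      refine ⟨p₁0, hp₁0, p₂0, hp₂0, ?_⟩
      have htI : t ∈ Icc 0 T := ⟨ht.1, ht.2.le⟩
      have hmt : -h ≤ t := by linarith [ht.1]
      have z1 : stopPath t p₁0.1 = stopPath t x := hp₁0.1.1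
      have z2 : stopPath t p₂0.1 = stopPath t x := hp₂0.1.1
      have e1 : φu t p₁0.1 = φu t x := by rw [hNu t htI, z1, ← hNu t htI]
      have e2 : φl t p₂0.1 = φl t x := by rw [hNl t htI, z2, ← hNl t htI]
      have e3 : lyapV (p₁0.1 - p₂0.1) t = 0 := by
        unfold lyapV
        rw [stopPath_sub, z1, z2, evalP_sub, evalP_eq_of_stopped ht.2.le z1 ⟨hmt, le_rfl⟩,
          evalP_eq_of_stopped ht.2.le z2 ⟨hmt, le_rfl⟩]
        simp
      rw [hP0, e1, e2, e3]
      simp [hG₀]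
    | succ i ih =>
      intro hi
      obtain ⟨p₁, hp₁, p₂, hp₂, hle⟩ := ih (by omega)
      obtain ⟨h1, h2, h3, h4⟩ := hP i (by omega)
      obtain ⟨q₁, hq₁, q₂, hq₂, hq⟩ := one_step hh hcu hcl hlam hg hR0 (fun ξ => rfl) ht
        (fun y hy => (hRu y hy).trans (hR ▸ le_max_left _ _))
        (fun y hy => (hRl y hy).trans (hR ▸ le_max_right _ _))
        hintu hintl hlip hU hL hη hεη h1 h2 h3 h4 hp₁ hp₂
      refine ⟨q₁, hq₁, q₂, hq₂, le_trans ?_ hq⟩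
      have hadj : (∫ ξ in t..(P i), g ξ) + (∫ ξ in (P i)..(P (i+1)), g ξ) =
          ∫ ξ in t..(P (i+1)), g ξ :=
        intervalIntegral.integral_add_adjacent_intervals
          (integ_sub hg ht.1 h1 (h2.le.trans h3)) (integ_sub hg (ht.1.trans h1) h2.le h3)
      rw [← hK, ← hadj]
      linarith
  obtain ⟨p₁, hp₁, p₂, hp₂, hle⟩ := key N le_rfl
  rw [hPN, ← hΛ] at hle
  have hm1 : p₁.1 ∈ D := hDu _ ⟨_, hp₁⟩
  have hm2 : p₂.1 ∈ D := hDl _ ⟨_, hp₂⟩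
  have hs1 := hM _ ⟨_, hm1, rfl⟩
  have hs2 := hM _ ⟨_, hm2, rfl⟩
  rw [Real.norm_eq_abs, abs_le] at hs1 hs2
  have hf1 := hφu p₁.1
  have hf2 := hφl p₂.1
  have hV : ‖p₁.1 - p₂.1‖ ^ 4 ≤ 2 * lyapV (p₁.1 - p₂.1) T := by
    unfold lyapV
    rw [stopPath_T]
    nlinarith [sq_nonneg (‖p₁.1 - p₂.1‖ ^ 2 - 2 * ‖evalP (p₁.1 - p₂.1) T‖ ^ 2)]
  have hcoef : Real.exp (-(10 * Λ)) / ε = 1 / η ^ 3 := by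
    rw [hεη]; field_simp
  rw [hcoef] at hle
  have hη3 : 0 < η ^ 3 := by positivity
  set VV := lyapV (p₁.1 - p₂.1) T
  have hVV0 : 0 ≤ VV := by have : 0 ≤ ‖p₁.1 - p₂.1‖ ^ 4 := by positivity
                           linarith
  have hb : 1 / η ^ 3 * VV ≤ 2 * M + G₀ := by linarith
  have hb2 : VV ≤ η ^ 3 * (2 * M + G₀) := by
    rw [one_div_mul_eq_div, div_le_iff₀ hη3] at hb
    linarith
  have hlt : ‖p₁.1 - p₂.1‖ < ρ := by
    refine lt_of_pow_lt_pow_left₀ 4 hρ.le ?_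
    linarith
  have hfin := hσρ _ hm1 _ hm2 (by rwa [dist_eq_norm])
  rw [Real.dist_eq, abs_lt] at hfin
  have : 0 ≤ 1 / η ^ 3 * VV := by positivity
  linarith

lemma full_ae {a b : ℝ} {E S : Set ℝ} (hE : E ⊆ Icc a b)
    (hvol : volume E = ENNReal.ofReal (b - a)) (hES : E ⊆ S)
    (hS : NullMeasurableSet S (volume.restrict (Icc a b))) :
    ∀ᵐ τ ∂(volume.restrict (Icc a b)), τ ∈ S := by
  rw [ae_iff]
  show (volume.restrict (Icc a b)) Sᶜ = 0
  rw [measure_compl₀ hS (measure_ne_top _ _), tsub_eq_zero_iff_le]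
  calc (volume.restrict (Icc a b)) univ = ENNReal.ofReal (b - a) := by simp
    _ = volume (E ∩ Icc a b) := by rw [inter_eq_left.2 hE, hvol]
    _ = (volume.restrict (Icc a b)) E := (Measure.restrict_apply' measurableSet_Icc).symm
    _ ≤ (volume.restrict (Icc a b)) S := measure_mono hES

lemma condA1_aem {n : ℕ} {h T : ℝ} {H : ℝ → PathSp n h T → Euc n → ℝ} (h1 : CondA1 H)
    (x : PathSp n h T) (s : Euc n) :
    AEMeasurable (fun τ => H τ x s) (volume.restrict (Icc 0 T)) :=
  aemeasurable_restrict_of_measurable_subtype measurableSet_Icc (h1 x s)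

lemma condA_integrable {n : ℕ} {h T : ℝ} {H : ℝ → PathSp n h T → Euc n → ℝ} {c : ℝ → ℝ}
    (hH : CondA H c) (y : PathSp n h T) (s : Euc n) :
    IntegrableOn (fun ξ => H ξ y s) (Icc 0 T) := by
  obtain ⟨h1, -, -, ⟨hc, E4, hE4, hv4, h4⟩, h5⟩ := hH
  obtain ⟨m, hm, hm5⟩ := h5 {y} isCompact_singleton
  obtain ⟨E5, hE5, hv5, h5'⟩ := hm5 y rfl
  have hst : Measurable (fun τ => ‖stopPath τ y‖) := (norm_stop_mono y).measurable
  have a5 : ∀ᵐ τ ∂(volume.restrict (Icc 0 T)), τ ∈ {τ | |H τ y 0| ≤ m τ} := by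
    refine full_ae hE5 (by rw [hv5, sub_zero]) h5' ?_
    exact nullMeasurableSet_le (condA1_aem h1 y 0).abs hm.1.1.aemeasurable
  have a4 : ∀ᵐ τ ∂(volume.restrict (Icc 0 T)), τ ∈ {τ | |H τ y s - H τ y 0| ≤
      c τ * (1 + ‖stopPath τ y‖) * ‖s - 0‖} := by
    refine full_ae hE4 (by rw [hv4, sub_zero]) (fun τ hτ => h4 τ hτ y s 0) ?_
    exact nullMeasurableSet_le ((condA1_aem h1 y s).sub (condA1_aem h1 y 0)).abs
      ((hc.1.1.aemeasurable.mul (hst.const_add 1).aemeasurable).mul_const _)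
  refine Integrable.mono' (g := fun τ => m τ + c τ * ((1 + ‖y‖) * ‖s‖))
    (hm.1.add (hc.1.mul_const _)) (condA1_aem h1 y s).aestronglyMeasurable ?_
  filter_upwards [a5, a4, ae_restrict_mem measurableSet_Icc] with τ b5 b4 hτ
  simp only [sub_zero] at b5 b4
  rw [Real.norm_eq_abs]
  have e1 : c τ * (1 + ‖stopPath τ y‖) * ‖s‖ ≤ c τ * ((1 + ‖y‖) * ‖s‖) := by
    rw [mul_assoc]
    have := hc.2 τ hτ
    have := norm_stop_le τ y
    gcongr
  have e2 := abs_sub_abs_le_abs_sub (H τ y s) (H τ y 0)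
  linarith

lemma ham_lip {n : ℕ} {h T : ℝ} (hh : 0 ≤ h)
    {H₁ H₂ : ℝ → PathSp n h T → Euc n → ℝ} {c₁ c₂ : ℝ → ℝ}
    (hH₁ : CondA H₁ c₁) (hH₂ : CondA H₂ c₂)
    {t : ℝ} (ht : t ∈ Set.Ico (0:ℝ) T) (x : PathSp n h T)
    (hcmp : ∀ y ∈ YSet t x c₁, ∃ E : Set ℝ, E ⊆ Set.Icc t T ∧
      volume E = ENNReal.ofReal (T - t) ∧
      ∀ τ ∈ E, ∀ s : Euc n, H₁ τ y s = H₂ τ y s) :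
    ∃ lam, IntegNonneg T lam ∧ ∀ y₁ ∈ YSet t x c₁, ∀ y₂ ∈ YSet t x c₂, ∀ s,
      ∀ᵐ ξ ∂(volume.restrict (Icc t T)), |H₁ ξ y₁ s - H₂ ξ y₂ s| ≤
        lam ξ * (1 + ‖s‖) * ‖stopPath ξ y₁ - stopPath ξ y₂‖ := by
  obtain ⟨lam, hlam, h3⟩ := hH₂.2.2.1 _
    ((yset_compact hh ht x hH₁.2.2.2.1.1).union (yset_compact hh ht x hH₂.2.2.2.1.1))
  refine ⟨lam, hlam, fun y₁ hy₁ y₂ hy₂ s => ?_⟩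
  have hsub : volume.restrict (Icc t T) ≤ volume.restrict (Icc 0 T) :=
    Measure.restrict_mono (Icc_subset_Icc_left ht.1) le_rfl
  obtain ⟨E, hE, hv, hEq⟩ := hcmp y₁ hy₁
  have b1 : ∀ᵐ τ ∂(volume.restrict (Icc t T)), τ ∈ {τ | H₁ τ y₁ s = H₂ τ y₁ s} := by
    refine full_ae hE hv (fun τ hτ => hEq τ hτ s) ?_
    exact nullMeasurableSet_eq_fun ((condA1_aem hH₁.1 y₁ s).mono_measure hsub)
      ((condA1_aem hH₂.1 y₁ s).mono_measure hsub)
  obtain ⟨F, hF, hFv, hFi⟩ := h3 y₁ (Or.inl (subset_closure hy₁)) y₂ (Or.inr (subset_closure hy₂)) s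
  have hst : Measurable (fun τ => ‖stopPath τ y₁ - stopPath τ y₂‖) := by
    have := (norm_stop_mono (y₁ - y₂)).measurable
    simpa only [stopPath_sub] using this
  have b2 : ∀ᵐ τ ∂(volume.restrict (Icc 0 T)), τ ∈ {τ | |H₂ τ y₁ s - H₂ τ y₂ s| ≤
      lam τ * (1 + ‖s‖) * ‖stopPath τ y₁ - stopPath τ y₂‖} := by
    refine full_ae hF (by rw [hFv, sub_zero]) hFi ?_
    exact nullMeasurableSet_le ((condA1_aem hH₂.1 y₁ s).sub (condA1_aem hH₂.1 y₂ s)).abs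
      ((hlam.1.1.aemeasurable.mul_const _).mul hst.aemeasurable)
  filter_upwards [b1, ae_mono hsub b2] with τ e1 e2
  have e1' : H₁ τ y₁ s = H₂ τ y₁ s := e1
  rw [e1']; exact e2

/-- Corollary: minimax solutions for Hamiltonians that agree
a.e. on `[t,T]` along every `y(·) ∈ Y(t,x(·);c_{H₁}(·))` agree at `(t,x(·))`. -/
theorem stmt12 {n : ℕ} {h T : ℝ} (hT : 0 < T) (hh : 0 ≤ h)
    (H₁ H₂ : ℝ → PathSp n h T → Euc n → ℝ) (c₁ c₂ : ℝ → ℝ)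
    (hH₁ : CondA H₁ c₁) (hH₂ : CondA H₂ c₂)
    (σ : PathSp n h T → ℝ) (hσ : Continuous σ)
    (φ₁ φ₂ : ℝ → PathSp n h T → ℝ)
    (h₁ : MinimaxSol H₁ c₁ σ φ₁) (h₂ : MinimaxSol H₂ c₂ σ φ₂)
    (t : ℝ) (ht : t ∈ Set.Ico (0:ℝ) T) (x : PathSp n h T)
    (hcmp : ∀ y ∈ YSet t x c₁, ∃ E : Set ℝ, E ⊆ Set.Icc t T ∧
      volume E = ENNReal.ofReal (T - t) ∧
      ∀ τ ∈ E, ∀ s : Euc n, H₁ τ y s = H₂ τ y s) :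
    φ₁ t x = φ₂ t x := by
  obtain ⟨lam, hlam, hlip⟩ := ham_lip hh hH₁ hH₂ ht x hcmp
  obtain ⟨⟨hN₁, -, hT₁, hU₁⟩, ⟨-, -, hT₁', hL₁⟩⟩ := h₁
  obtain ⟨⟨hN₂, -, hT₂, hU₂⟩, ⟨-, -, hT₂', hL₂⟩⟩ := h₂
  have hc₁ := hH₁.2.2.2.1.1
  have hc₂ := hH₂.2.2.2.1.1
  refine le_antisymm ?_ ?_
  · refine comparison hh hc₂ hc₁ hlam ht (condA_integrable hH₂) (condA_integrable hH₁) ?_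
      hU₂ hL₁ hσ hN₂ hN₁ hT₂ hT₁'
    intro y₂ hy₂ y₁ hy₁ s
    filter_upwards [hlip y₁ hy₁ y₂ hy₂ s] with ξ hξ
    rwa [abs_sub_comm, norm_sub_rev]
  · exact comparison hh hc₁ hc₂ hlam ht (condA_integrable hH₁) (condA_integrable hH₂) hlip
      hU₁ hL₂ hσ hN₁ hN₂ hT₁ hT₂'

end
end
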